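/- arXiv:2304.01368 — 2 statements merged into one kernel-verified Lean document; each statement's English description precedes it below -/
import Mathlib

section
/- Let k ≥ 2 and let G be a 3k-connected finite simple graph with n = |V(G)| ≥ 4k vertices that has a perfect matching. Then the bound of the main theorem is not attained: 2·𝓈(G) > 3n + 2k (i.e., 𝓈(G) > 3n/2 + k). -/
/-! Definitions for the slow coloring game (sum-color cost), paintability,
connectivity and auxiliary graphs. -/

variable {V : Type*}

/-- `D` is a maximal independent subset of `M` with respect to `G`:
`D ⊆ M`, `D` is independent in `G`, and every vertex of `M \ D` has a neighbor in `D`. -/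
def SimpleGraph.MaxIndepSubset (G : SimpleGraph V) (M D : Finset V) : Prop :=
  D ⊆ M ∧ (∀ u ∈ D, ∀ v ∈ D, ¬ G.Adj u v) ∧ ∀ v ∈ M, v ∉ D → ∃ u ∈ D, G.Adj u v

/-- Fueled recursion computing the slow coloring number of the subgraph of `G`
induced on the vertex set `A`.  In each round Lister marks a nonempty `M ⊆ A`,
scoring `|M|`, and Painter deletes a maximal independent subset `D` of `M`
(such a `D` is necessarily nonempty, so the game ends within `A.card` rounds;
hence the value is correct whenever the fuel is at least `A.card`). -/
noncomputable def SimpleGraph.slowAux [DecidableEq V] (G : SimpleGraph V) :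
    ℕ → Finset V → ℕ
  | 0, _ => 0
  | fuel + 1, A =>
    (A.powerset.filter fun M => M.Nonempty).sup fun M =>
      M.card + sInf {m | ∃ D : Finset V, G.MaxIndepSubset M D ∧ m = G.slowAux fuel (A \ D)}

/-- The slow coloring number (sum-color cost) `𝓈(G)` of a finite simple graph `G`. -/
noncomputable def SimpleGraph.sumColorCost [Fintype V] [DecidableEq V]
    (G : SimpleGraph V) : ℕ :=
  G.slowAux (Fintype.card V) Finset.univ

/-- `G` is `m`-connected: it has more than `m` vertices and deleting any set of
fewer than `m` vertices leaves a connected graph. -/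
def SimpleGraph.MConnected [Fintype V] [DecidableEq V] (G : SimpleGraph V) (m : ℕ) : Prop :=
  m < Fintype.card V ∧
    ∀ S : Finset V, S.card < m →
      (G.induce ((Finset.univ \ S : Finset V) : Set V)).Connected

/-- The independence number `α(G)`: the maximum size of a set of pairwise
nonadjacent vertices. -/
noncomputable def SimpleGraph.indepNumber (G : SimpleGraph V) : ℕ :=
  sSup {n | ∃ s : Set V, (∀ u ∈ s, ∀ v ∈ s, ¬ G.Adj u v) ∧ s.ncard = n}

/-- Fueled recursion for the `f`-painting game of `G` restricted to the vertex
set `A`: the empty graph is `f`-paintable, and a nonempty graph is `f`-paintable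
iff every vertex has at least one token and, for every nonempty marked set `M`,
Painter can delete some maximal independent subset `D` of `M` so that the rest
is paintable after each vertex of `M \ D` loses a token. -/
def SimpleGraph.paintAux [DecidableEq V] (G : SimpleGraph V) :
    ℕ → Finset V → (V → ℕ) → Prop
  | 0, A, _ => A = ∅
  | fuel + 1, A, f =>
    A = ∅ ∨ ((∀ v ∈ A, 1 ≤ f v) ∧
      ∀ M ⊆ A, M.Nonempty → ∃ D : Finset V, G.MaxIndepSubset M D ∧
        G.paintAux fuel (A \ D) (fun v => if v ∈ M \ D then f v - 1 else f v))

/-- `G` is `f`-paintable. -/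
def SimpleGraph.Paintable [Fintype V] [DecidableEq V] (G : SimpleGraph V) (f : V → ℕ) : Prop :=
  G.paintAux (Fintype.card V) Finset.univ f

/-- The sum-paintability `χ_SP(G)`: the least total number of tokens `∑ v, f v`
over functions `f` for which `G` is `f`-paintable. -/
noncomputable def SimpleGraph.sumPaintability [Fintype V] [DecidableEq V]
    (G : SimpleGraph V) : ℕ :=
  sInf {s | ∃ f : V → ℕ, G.Paintable f ∧ s = ∑ v, f v}

/-- The triangular prism graph on vertices `0,…,5` (a triangle `0,1,2`, a
triangle `3,4,5`, and the matching `03, 14, 25`). -/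
def prismGraph : SimpleGraph (Fin 6) :=
  SimpleGraph.fromRel fun u v =>
    ((u : ℕ), (v : ℕ)) ∈ [(0,1), (1,2), (0,2), (3,4), (4,5), (3,5), (0,3), (1,4), (2,5)]

/-- The star `K_{1,n-1}` on `n` vertices, with center `0`. -/
def starGraph (n : ℕ) : SimpleGraph (Fin n) :=
  SimpleGraph.fromRel fun u _ => (u : ℕ) = 0

namespace SlowCol
open Finset

section
variable {V : Type*} [DecidableEq V] (G : SimpleGraph V)

/-- slow coloring number of the subgraph induced on `A`. -/
noncomputable def sc (A : Finset V) : ℕ := G.slowAux A.card A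

lemma exists_maxIndep (M : Finset V) (_hM : M.Nonempty) :
    ∃ D, G.MaxIndepSubset M D := by
  classical
  let F := M.powerset.filter (fun D => ∀ u ∈ D, ∀ v ∈ D, ¬ G.Adj u v)
  have hF : F.Nonempty := ⟨∅, by simp [F]⟩
  obtain ⟨D, hD, hmax⟩ := F.exists_max_image (fun D => D.card) hF
  simp only [F, mem_filter, mem_powerset] at hD hmax
  refine ⟨D, hD.1, hD.2, ?_⟩
  intro v hv hvD
  by_contra hcon
  push Not at hcon
  have := hmax (insert v D) ⟨?_, ?_⟩
  · rw [card_insert_of_notMem hvD] at this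
    omega
  · exact insert_subset hv hD.1
  · intro a ha b hb
    rw [mem_insert] at ha hb
    rcases ha with rfl | ha <;> rcases hb with rfl | hb
    · exact G.irrefl
    · exact fun h => hcon b hb h.symm
    · exact hcon a ha
    · exact hD.2 a ha b hb

lemma maxIndep_nonempty {M D : Finset V} (hM : M.Nonempty) (h : G.MaxIndepSubset M D) :
    D.Nonempty := by
  obtain ⟨v, hv⟩ := hM
  by_cases hvD : v ∈ D
  · exact ⟨v, hvD⟩
  · obtain ⟨u, hu, _⟩ := h.2.2 v hv hvD
    exact ⟨u, hu⟩

lemma slowAux_congr : ∀ (n m : ℕ) (A : Finset V), A.card ≤ n → A.card ≤ m →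
    G.slowAux n A = G.slowAux m A := by
  have h0 : ∀ m : ℕ, G.slowAux m (∅ : Finset V) = 0 := by
    intro m
    cases m with
    | zero => rfl
    | succ m =>
      simp only [SimpleGraph.slowAux]
      apply Nat.eq_zero_of_le_zero
      apply Finset.sup_le
      intro M hM
      simp at hM
      exact absurd hM.1 hM.2.ne_empty
  intro n
  induction n with
  | zero =>
    intro m A hA _
    have : A = ∅ := by simpa using hA
    subst this
    rw [h0, h0]
  | succ n ih =>
    intro m A hA hm
    cases m with
    | zero =>
      have : A = ∅ := by simpa using hm
      subst this
      rw [h0, h0]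
    | succ m =>
      simp only [SimpleGraph.slowAux]
      apply Finset.sup_congr rfl
      intro M hM
      simp only [mem_filter, mem_powerset] at hM
      congr 2
      ext x
      simp only [Set.mem_ofPred_eq]
      apply exists_congr
      intro D
      apply and_congr_right
      intro hD
      have hne := maxIndep_nonempty G hM.2 hD
      have hlt : (A \ D).card < A.card := by
        apply card_lt_card
        refine ⟨sdiff_subset, fun h => ?_⟩
        obtain ⟨v, hv⟩ := hne
        have := h (hM.1 (hD.1 hv))
        simp at this
        exact this.2 hv
      rw [ih m (A \ D) (by omega) (by omega)]

lemma sc_eq {A : Finset V} {n : ℕ} (h : A.card ≤ n) : G.slowAux n A = sc G A :=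
  slowAux_congr G _ _ A h le_rfl

lemma card_sdiff_lt {A M D : Finset V} (hM : M ⊆ A) (hne : M.Nonempty)
    (hD : G.MaxIndepSubset M D) : (A \ D).card < A.card := by
  apply card_lt_card
  refine ⟨sdiff_subset, fun h => ?_⟩
  obtain ⟨v, hv⟩ := maxIndep_nonempty G hne hD
  have := h (hM (hD.1 hv))
  simp at this
  exact this.2 hv

lemma sc_unfold (A : Finset V) (hA : A.Nonempty) :
    sc G A = (A.powerset.filter fun M => M.Nonempty).sup fun M =>
      M.card + sInf {m | ∃ D : Finset V, G.MaxIndepSubset M D ∧ m = sc G (A \ D)} := by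
  have hc : A.card = (A.card - 1) + 1 := by have := hA.card_pos; omega
  unfold sc
  rw [hc]
  simp only [SimpleGraph.slowAux]
  apply Finset.sup_congr rfl
  intro M hM
  simp only [mem_filter, mem_powerset] at hM
  congr 2
  ext x
  simp only [Set.mem_ofPred_eq]
  apply exists_congr
  intro D
  apply and_congr_right
  intro hD
  have := card_sdiff_lt G hM.1 hM.2 hD
  rw [slowAux_congr G (A.card - 1) (A \ D).card (A \ D) (by omega) le_rfl]

lemma sc_step {A M : Finset V} {c : ℕ} (hM : M ⊆ A) (hne : M.Nonempty)
    (h : ∀ D, G.MaxIndepSubset M D → c ≤ M.card + sc G (A \ D)) : c ≤ sc G A := by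
  rw [sc_unfold G A (hne.mono hM)]
  have hmem : M ∈ A.powerset.filter fun M => M.Nonempty := by simp [hM, hne]
  refine le_trans ?_ (Finset.le_sup hmem)
  have hn : ({m | ∃ D : Finset V, G.MaxIndepSubset M D ∧ m = sc G (A \ D)} : Set ℕ).Nonempty := by
    obtain ⟨D, hD⟩ := exists_maxIndep G M hne
    exact ⟨_, D, hD, rfl⟩
  obtain ⟨D, hD, hDe⟩ := Nat.sInf_mem hn
  rw [hDe]
  exact h D hD

lemma sc_opt {A : Finset V} (hA : A.Nonempty) :
    ∃ M ⊆ A, M.Nonempty ∧ ∀ D, G.MaxIndepSubset M D → sc G A ≤ M.card + sc G (A \ D) := by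
  rw [sc_unfold G A hA]
  have hs : (A.powerset.filter fun M => M.Nonempty).Nonempty := ⟨A, by simp [hA]⟩
  obtain ⟨M, hM, he⟩ := Finset.exists_mem_eq_sup _ hs (fun M =>
      M.card + sInf {m | ∃ D : Finset V, G.MaxIndepSubset M D ∧ m = sc G (A \ D)})
  simp only [mem_filter, mem_powerset] at hM
  refine ⟨M, hM.1, hM.2, ?_⟩
  intro D hD
  rw [he]
  apply Nat.add_le_add_left
  apply Nat.sInf_le
  exact ⟨D, hD, rfl⟩

lemma sc_add : ∀ (n : ℕ) (X Y : Finset V), X.card ≤ n → Disjoint X Y →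
    sc G X + sc G Y ≤ sc G (X ∪ Y) := by
  intro n
  induction n with
  | zero =>
    intro X Y hX _
    have : X = ∅ := by simpa using hX
    subst this
    simp [sc, SimpleGraph.slowAux]
  | succ n ih =>
    intro X Y hX hd
    rcases X.eq_empty_or_nonempty with rfl | hne
    · simp [sc, SimpleGraph.slowAux]
    obtain ⟨M, hM, hMn, hopt⟩ := sc_opt G hne
    apply sc_step G (hM.trans subset_union_left) hMn
    intro D hD
    have hDX : D ⊆ X := hD.1.trans hM
    have h1 := hopt D hD
    have h2 : (X ∪ Y) \ D = (X \ D) ∪ Y := by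
      rw [union_sdiff_distrib]
      congr 1
      exact sdiff_eq_self_of_disjoint (hd.symm.mono_right hDX)
    have h3 := ih (X \ D) Y (by have := card_sdiff_lt G hM hMn hD; omega)
      (hd.mono_left sdiff_subset)
    rw [h2]
    omega

lemma sc_superadd {X Y A : Finset V} (hd : Disjoint X Y) (hA : X ∪ Y = A) :
    sc G X + sc G Y ≤ sc G A := hA ▸ sc_add G _ X Y le_rfl hd

lemma sc_mono {X A : Finset V} (h : X ⊆ A) : sc G X ≤ sc G A := by
  have := sc_superadd G (X := X) (Y := A \ X) (A := A) disjoint_sdiff (by simp [h])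
  omega

lemma sc_ge_card (A : Finset V) : A.card ≤ sc G A := by
  rcases A.eq_empty_or_nonempty with rfl | h
  · simp
  exact sc_step G (Subset.refl A) h (fun D _ => by omega)

/-- mark two completely joined sets -/
lemma sc_mark {A P Q : Finset V} {c : ℕ} (hP : P ⊆ A) (hQ : Q ⊆ A) (hPn : P.Nonempty)
    (hadj : ∀ p ∈ P, ∀ q ∈ Q, G.Adj p q)
    (h1 : c ≤ P.card + Q.card + sc G (A \ P)) (h2 : c ≤ P.card + Q.card + sc G (A \ Q)) :
    c ≤ sc G A := by
  have hd : Disjoint P Q := by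
    rw [disjoint_left]
    intro a ha hb
    exact G.irrefl (hadj a ha a hb)
  apply sc_step G (M := P ∪ Q) (union_subset hP hQ) (hPn.mono subset_union_left)
  intro D hD
  rw [card_union_of_disjoint hd]
  by_cases hDP : D ⊆ P
  · exact h1.trans (Nat.add_le_add_left (sc_mono G (sdiff_subset_sdiff le_rfl hDP)) _)
  · have hDQ : D ⊆ Q := by
      obtain ⟨q, hq, hqP⟩ := not_subset.1 hDP
      have hqQ : q ∈ Q := by
        have := hD.1 hq
        rw [mem_union] at this
        tauto
      intro x hx
      have := hD.1 hx
      rw [mem_union] at this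
      rcases this with h | h
      · exact absurd (hadj x h q hqQ) (hD.2.1 x hx q hq)
      · exact h
    exact h2.trans (Nat.add_le_add_left (sc_mono G (sdiff_subset_sdiff le_rfl hDQ)) _)

lemma sc_edge {A : Finset V} {u v : V} {c : ℕ} (hu : u ∈ A) (hv : v ∈ A) (h : G.Adj u v)
    (h1 : c ≤ 2 + sc G (A.erase u)) (h2 : c ≤ 2 + sc G (A.erase v)) : c ≤ sc G A := by
  apply sc_mark G (P := {u}) (Q := {v}) (by simpa using hu) (by simpa using hv) (by simp)
  · intro p hp q hq
    simp at hp hq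
    subst hp hq
    exact h
  · simpa [sdiff_singleton_eq_erase] using h1
  · simpa [sdiff_singleton_eq_erase] using h2

lemma sc_triangle {A : Finset V} {a b d : V} {c : ℕ} (ha : a ∈ A) (hb : b ∈ A) (hd : d ∈ A)
    (hab : G.Adj a b) (hbd : G.Adj b d) (had : G.Adj a d)
    (h : ∀ x, x ∈ A → c ≤ 3 + sc G (A.erase x)) : c ≤ sc G A := by
  apply sc_step G (M := {a, b, d})
  · intro x hx
    simp at hx
    rcases hx with rfl | rfl | rfl <;> assumption
  · simp
  · intro D hD
    have hcard : ({a, b, d} : Finset V).card = 3 := by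
      rw [card_eq_three]
      exact ⟨a, b, d, hab.ne, had.ne, hbd.ne, rfl⟩
    rw [hcard]
    obtain ⟨x, hx⟩ := maxIndep_nonempty G (by simp) hD
    have hxM := hD.1 hx
    have hDx : D ⊆ {x} := by
      intro y hy
      have hyM := hD.1 hy
      have hna := hD.2.1 x hx y hy
      simp only [mem_insert, mem_singleton] at hxM hyM ⊢
      have := hab.symm
      have := hbd.symm
      have := had.symm
      rcases hxM with rfl | rfl | rfl <;> rcases hyM with rfl | rfl | rfl <;> first | rfl | contradiction
    have hxA : x ∈ A := by
      simp at hxM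
      rcases hxM with rfl | rfl | rfl <;> assumption
    refine (h x hxA).trans (Nat.add_le_add_left (sc_mono G ?_) _)
    rw [← sdiff_singleton_eq_erase]
    exact sdiff_subset_sdiff le_rfl hDx

end
end SlowCol

namespace SlowCol
open Finset

section
set_option linter.unusedSectionVars false
set_option linter.unusedVariables false
variable {V : Type*} [DecidableEq V] (G : SimpleGraph V)

open Classical in
/-- vertices of `L` adjacent to some vertex of `Q`. -/
noncomputable def nb (Q L : Finset V) : Finset V := L.filter (fun l => ∃ q ∈ Q, G.Adj q l)

open Classical in
/-- number of neighbours of `v` in `A`. -/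
noncomputable def dg (A : Finset V) (v : V) : ℕ := (A.filter (fun c => G.Adj c v)).card

/-- Hall condition with surplus `j`. -/
def HC (j : ℕ) (C L : Finset V) : Prop :=
  Disjoint C L ∧ ∀ Q ⊆ C, Q.Nonempty → Q.card + j ≤ (nb G Q L).card

/-- The slow coloring number of `C ∪ L` is at least `|L| + 2|C| + g`. -/
def Gn (C L : Finset V) (g : ℕ) : Prop := L.card + 2 * C.card + g ≤ sc G (C ∪ L)

variable {G}

lemma mem_nb {Q L : Finset V} {l : V} : l ∈ nb G Q L ↔ l ∈ L ∧ ∃ q ∈ Q, G.Adj q l := by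
  simp [nb]

lemma nb_subset (Q L : Finset V) : nb G Q L ⊆ L := fun _ h => (mem_nb.1 h).1

lemma nb_mono {Q Q' L : Finset V} (h : Q ⊆ Q') : nb G Q L ⊆ nb G Q' L := by
  intro l hl
  rw [mem_nb] at hl ⊢
  obtain ⟨h1, q, hq, ha⟩ := hl
  exact ⟨h1, q, h hq, ha⟩

lemma nb_mono_right {Q L L' : Finset V} (h : L ⊆ L') : nb G Q L ⊆ nb G Q L' := by
  intro l hl
  rw [mem_nb] at hl ⊢
  exact ⟨h hl.1, hl.2⟩

lemma nb_union (Q R L : Finset V) : nb G (Q ∪ R) L = nb G Q L ∪ nb G R L := by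
  ext l
  simp only [mem_nb, mem_union]
  constructor
  · rintro ⟨h, q, hq | hq, ha⟩
    · exact Or.inl ⟨h, q, hq, ha⟩
    · exact Or.inr ⟨h, q, hq, ha⟩
  · rintro (⟨h, q, hq, ha⟩ | ⟨h, q, hq, ha⟩)
    · exact ⟨h, q, Or.inl hq, ha⟩
    · exact ⟨h, q, Or.inr hq, ha⟩

lemma nb_sdiff (Q L P : Finset V) : nb G Q (L \ P) = nb G Q L \ P := by
  ext l
  simp only [mem_nb, mem_sdiff]
  tauto

lemma nb_erase (Q L : Finset V) (p : V) : nb G Q (L.erase p) = (nb G Q L).erase p := by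
  ext l
  simp only [mem_nb, mem_erase]
  tauto

lemma nb_nb {R Q L : Finset V} (h : R ⊆ Q) : nb G R (nb G Q L) = nb G R L := by
  ext l
  simp only [mem_nb]
  constructor
  · rintro ⟨⟨h1, _⟩, h2⟩
    exact ⟨h1, h2⟩
  · rintro ⟨h1, q, hq, ha⟩
    exact ⟨⟨h1, q, h hq, ha⟩, q, hq, ha⟩

lemma nb_card_rest (Q R L : Finset V) :
    (nb G R (L \ nb G Q L)).card + (nb G Q L).card = (nb G (Q ∪ R) L).card := by
  rw [nb_sdiff, nb_union, union_comm, card_sdiff_add_card]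

lemma nb_card_inter (Q R L : Finset V) :
    (nb G (Q ∪ R) L).card + (nb G Q L ∩ nb G R L).card = (nb G Q L).card + (nb G R L).card := by
  rw [nb_union, card_union_add_card_inter]

lemma dg_mono {A B : Finset V} {v : V} (h : ∀ c ∈ A, G.Adj c v → c ∈ B) : dg G A v ≤ dg G B v := by
  apply card_le_card
  intro c hc
  simp only [mem_filter] at hc ⊢
  exact ⟨h c hc.1 hc.2, hc.2⟩

lemma dg_le_card (A : Finset V) (v : V) : dg G A v ≤ A.card := by
  classical
  unfold dg
  exact card_filter_le _ _

lemma dg_pos {A : Finset V} {v : V} (h : 1 ≤ dg G A v) : ∃ c ∈ A, G.Adj c v := by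
  obtain ⟨c, hc⟩ := card_pos.1 h
  simp only [mem_filter] at hc
  exact ⟨c, hc⟩

lemma dg_pos' {A : Finset V} {v c : V} (h : c ∈ A) (h2 : G.Adj c v) : 1 ≤ dg G A v := by
  apply card_pos.2
  exact ⟨c, by simp [h, h2]⟩

lemma dg_sdiff (A B : Finset V) (v : V) : dg G A v ≤ dg G (A \ B) v + B.card := by
  classical
  unfold dg
  calc _ ≤ ((A \ B).filter (fun c => G.Adj c v) ∪ B).card := by
        apply card_le_card
        intro c hc
        simp only [mem_filter, mem_union, mem_sdiff] at hc ⊢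
        tauto
    _ ≤ _ := card_union_le _ _

lemma dg_erase (A : Finset V) (b v : V) : dg G A v ≤ dg G (A.erase b) v + 1 := by
  have := dg_sdiff (G := G) A {b} v
  rwa [card_singleton, sdiff_singleton_eq_erase] at this

lemma dg_erase_of_not_adj (A : Finset V) {b v : V} (h : ¬ G.Adj b v) :
    dg G A v ≤ dg G (A.erase b) v := by
  apply dg_mono
  intro c hc hcv
  rw [mem_erase]
  refine ⟨?_, hc⟩
  rintro rfl
  exact h hcv

lemma nb_singleton_card (c : V) (L : Finset V) : (nb G {c} L).card = dg G L c := by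
  unfold nb dg
  congr 1
  ext l
  simp [G.adj_comm]

lemma HC.mono_left {j : ℕ} {C C' L : Finset V} (h : HC G j C L) (hs : C' ⊆ C) : HC G j C' L :=
  ⟨h.1.mono_left hs, fun Q hQ hn => h.2 Q (hQ.trans hs) hn⟩

lemma HC.mono_right {j : ℕ} {C L L' : Finset V} (h : HC G j C L) (hs : L ⊆ L')
    (hd : Disjoint C L') : HC G j C L' :=
  ⟨hd, fun Q hQ hn => (h.2 Q hQ hn).trans (card_le_card (nb_mono_right hs))⟩

lemma HC.weaken {i j : ℕ} {C L : Finset V} (h : HC G j C L) (hs : i ≤ j) : HC G i C L :=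
  ⟨h.1, fun Q hQ hn => by have := h.2 Q hQ hn; omega⟩

lemma HC.erase_leaf {j : ℕ} {C L : Finset V} (h : HC G (j + 1) C L) (l : V) :
    HC G j C (L.erase l) := by
  refine ⟨h.1.mono_right (erase_subset _ _), fun Q hQ hn => ?_⟩
  have := h.2 Q hQ hn
  rw [nb_erase]
  have := pred_card_le_card_erase (s := nb G Q L) (a := l)
  omega

lemma HC.card {j : ℕ} {C L : Finset V} (h : HC G j C L) (hn : C.Nonempty) :
    C.card + j ≤ L.card :=
  (h.2 C Subset.rfl hn).trans (card_le_card (nb_subset _ _))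

lemma HC.card0 {j : ℕ} {C L : Finset V} (h : HC G j C L) : C.card ≤ L.card := by
  rcases C.eq_empty_or_nonempty with rfl | hn
  · simp
  · have := h.card hn
    omega

/-! ### Hall -/

lemma hall {C L : Finset V} (h : HC G 0 C L) :
    ∃ f : V → V, (∀ c ∈ C, f c ∈ L ∧ G.Adj c (f c)) ∧ Set.InjOn f C := by
  classical
  have key := (Finset.all_card_le_biUnion_card_iff_exists_injective
    (fun c : C => nb G {c.1} L)).1 ?_
  · obtain ⟨f, hf, hfm⟩ := key
    refine ⟨fun v => if hv : v ∈ C then f ⟨v, hv⟩ else v, ?_, ?_⟩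
    · intro c hc
      have := hfm ⟨c, hc⟩
      rw [mem_nb] at this
      simpa [hc] using this
    · intro a ha b hb hab
      have ha' : a ∈ C := ha
      have hb' : b ∈ C := hb
      simp only [ha', hb', dif_pos] at hab
      have := hf hab
      simpa using this
  · intro s
    rcases s.eq_empty_or_nonempty with rfl | hn
    · simp
    have h1 := h.2 (s.image Subtype.val) (by
      intro x hx
      simp at hx
      exact hx.1) (hn.image _)
    rw [card_image_of_injective _ Subtype.val_injective] at h1
    refine h1.trans (card_le_card ?_)
    intro l hl
    rw [mem_nb] at hl
    obtain ⟨hlL, q, hq, ha⟩ := hl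
    simp only [mem_image] at hq
    obtain ⟨c, hc, rfl⟩ := hq
    rw [mem_biUnion]
    exact ⟨c, hc, mem_nb.2 ⟨hlL, c.1, by simp, ha⟩⟩

lemma hall_conv {C L : Finset V} (hd : Disjoint C L) (f : V → V)
    (h1 : ∀ c ∈ C, f c ∈ L ∧ G.Adj c (f c)) (h2 : Set.InjOn f C) : HC G 0 C L := by
  refine ⟨hd, fun Q hQ _ => ?_⟩
  have : (Q.image f).card = Q.card :=
    card_image_of_injOn (h2.mono (by exact_mod_cast hQ))
  rw [add_zero, ← this]
  apply card_le_card
  intro x hx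
  rw [mem_image] at hx
  obtain ⟨c, hc, rfl⟩ := hx
  exact mem_nb.2 ⟨(h1 c (hQ hc)).1, c, hc, (h1 c (hQ hc)).2⟩

lemma HC.drop {C L : Finset V} (h : HC G 0 C L) (hlt : C.card < L.card) :
    ∃ l ∈ L, HC G 0 C (L.erase l) := by
  obtain ⟨f, h1, h2⟩ := hall h
  have hc : (C.image f).card < L.card := by
    rw [card_image_of_injOn h2]
    exact hlt
  obtain ⟨l, hl, hn⟩ := exists_mem_notMem_of_card_lt_card hc
  refine ⟨l, hl, hall_conv (h.1.mono_right (erase_subset _ _)) f ?_ h2⟩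
  intro c hc
  refine ⟨mem_erase.2 ⟨?_, (h1 c hc).1⟩, (h1 c hc).2⟩
  rintro rfl
  exact hn (mem_image_of_mem _ hc)

lemma HC.drop_to {C L : Finset V} (h : HC G 0 C L) {n : ℕ} (hn1 : C.card ≤ n) (hn2 : n ≤ L.card) :
    ∃ L' ⊆ L, L'.card = n ∧ HC G 0 C L' := by
  obtain ⟨m, hm⟩ : ∃ m, L.card = n + m := ⟨L.card - n, by omega⟩
  clear hn2
  induction m generalizing L with
  | zero => exact ⟨L, Subset.rfl, hm, h⟩
  | succ m ih =>
    obtain ⟨l, hl, hH⟩ := h.drop (by omega)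
    obtain ⟨L', h1, h2, h3⟩ := ih hH (by rw [card_erase_of_mem hl]; omega)
    exact ⟨L', h1.trans (erase_subset _ _), h2, h3⟩

lemma HC.swap {C L : Finset V} (h : HC G 0 C L) (hc : C.card = L.card) : HC G 0 L C := by
  obtain ⟨f, h1, h2⟩ := hall h
  have himg : C.image f = L := by
    apply eq_of_subset_of_card_le
    · intro x hx
      rw [mem_image] at hx
      obtain ⟨c, hc, rfl⟩ := hx
      exact (h1 c hc).1
    · rw [card_image_of_injOn h2, hc]
  have hinv : ∀ l ∈ L, ∃ c ∈ C, f c = l := by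
    intro l hl
    rw [← himg, mem_image] at hl
    exact hl
  choose! g hg using hinv
  refine hall_conv h.1.symm g ?_ ?_
  · intro l hl
    refine ⟨(hg l hl).1, ?_⟩
    have := (h1 _ (hg l hl).1).2
    rw [(hg l hl).2] at this
    exact this.symm
  · intro a ha b hb hab
    rw [← (hg a ha).2, ← (hg b hb).2, hab]

/-! ### gains -/

lemma Gn.weaken {C L : Finset V} {a b : ℕ} (h : Gn G C L b) (hab : a ≤ b) : Gn G C L a := by
  unfold Gn at *
  omega

lemma Gn.swap {C L : Finset V} {a : ℕ} (h : Gn G C L a) (hc : C.card = L.card) : Gn G L C a := by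
  unfold Gn at *
  rw [union_comm]
  omega

lemma Gn.leaf {C L L' : Finset V} {g : ℕ} (h : Gn G C L' g) (hs : L' ⊆ L) (hd : Disjoint C L) :
    Gn G C L g := by
  unfold Gn at *
  have h1 := sc_superadd G (X := C ∪ L') (Y := L \ L') (A := C ∪ L) (by
    rw [disjoint_union_left]
    exact ⟨hd.mono_right sdiff_subset, disjoint_sdiff⟩) (by
    rw [union_assoc, union_sdiff_of_subset hs])
  have h2 := sc_ge_card G (L \ L')
  have h3 := card_sdiff_add_card_eq_card hs
  omega

lemma Gn.split {C L C1 L1 : Finset V} {a b g : ℕ} (hd : Disjoint C L) (hC : C1 ⊆ C) (hL : L1 ⊆ L)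
    (h1 : Gn G C1 L1 a) (h2 : Gn G (C \ C1) (L \ L1) b) (hg : g ≤ a + b) : Gn G C L g := by
  unfold Gn at *
  have h3 := sc_superadd G (X := C1 ∪ L1) (Y := (C \ C1) ∪ (L \ L1)) (A := C ∪ L) (by
    rw [disjoint_union_left, disjoint_union_right, disjoint_union_right]
    exact ⟨⟨disjoint_sdiff, hd.mono hC sdiff_subset⟩,
      ⟨(hd.mono sdiff_subset hL).symm, disjoint_sdiff⟩⟩) (by
    ext x
    have := @hC x
    have := @hL x
    simp only [mem_union, mem_sdiff]
    tauto)
  have h4 := card_sdiff_add_card_eq_card hC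
  have h5 := card_sdiff_add_card_eq_card hL
  omega

lemma Gn.mark {C L P Q : Finset V} {a b g : ℕ} (hd : Disjoint C L) (hP : P ⊆ L) (hQ : Q ⊆ C)
    (hPn : P.Nonempty) (hadj : ∀ p ∈ P, ∀ q ∈ Q, G.Adj p q)
    (h1 : Gn G C (L \ P) a) (h2 : Gn G (C \ Q) L b)
    (ha : g ≤ a + Q.card) (hb : g + Q.card ≤ b + P.card) : Gn G C L g := by
  unfold Gn at *
  have h4 := card_sdiff_add_card_eq_card hP
  have h5 := card_sdiff_add_card_eq_card hQ
  apply sc_mark G (P := P) (Q := Q) (hP.trans subset_union_right) (hQ.trans subset_union_left)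
    hPn hadj
  · have e : (C ∪ L) \ P = C ∪ (L \ P) := by
      rw [union_sdiff_distrib, sdiff_eq_self_of_disjoint (hd.mono_right hP)]
    rw [e]
    omega
  · have e : (C ∪ L) \ Q = (C \ Q) ∪ L := by
      rw [union_sdiff_distrib, sdiff_eq_self_of_disjoint (hd.symm.mono_right hQ)]
    rw [e]
    omega

lemma Gn.edge {C L : Finset V} {c l : V} {a g : ℕ} (hd : Disjoint C L) (hc : c ∈ C) (hl : l ∈ L)
    (h : G.Adj c l) (h1 : Gn G C (L.erase l) a) (h2 : Gn G (C.erase c) L g)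
    (ha : g ≤ a + 1) : Gn G C L g := by
  apply Gn.mark (P := {l}) (Q := {c}) (a := a) (b := g) hd (by simpa using hl) (by simpa using hc)
    (by simp)
  · intro p hp q hq
    simp at hp hq
    subst hp hq
    exact h.symm
  · rwa [sdiff_singleton_eq_erase]
  · rwa [sdiff_singleton_eq_erase]
  · simpa using ha
  · simp

lemma Gn.cherry {C L : Finset V} {c l l' : V} {a b g : ℕ} (hd : Disjoint C L) (hc : c ∈ C)
    (hl : l ∈ L) (hl' : l' ∈ L) (hne : l ≠ l')
    (h : G.Adj c l) (h' : G.Adj c l') (h1 : Gn G C ((L.erase l).erase l') a)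
    (h2 : Gn G (C.erase c) L b)
    (ha : g ≤ a + 1) (hb : g ≤ b + 1) : Gn G C L g := by
  apply Gn.mark (P := {l, l'}) (Q := {c}) (a := a) (b := b) hd ?_ (by simpa using hc)
    (by simp)
  · intro p hp q hq
    simp at hp hq
    subst hq
    rcases hp with rfl | rfl
    · exact h.symm
    · exact h'.symm
  · have : L \ {l, l'} = (L.erase l).erase l' := by
      ext x
      simp only [mem_sdiff, mem_insert, mem_singleton, mem_erase]
      tauto
    rwa [this]
  · rwa [sdiff_singleton_eq_erase]
  · simpa using ha
  · rw [card_pair hne]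
    simp
    omega
  · intro x hx
    simp at hx
    rcases hx with rfl | rfl <;> assumption

lemma Gn.base {C L : Finset V} (h : HC G 0 C L) : Gn G C L 0 := by
  obtain ⟨f, h1, h2⟩ := hall h
  have hd := h.1
  clear h
  induction C using Finset.induction_on generalizing L with
  | empty =>
    unfold Gn
    simpa using sc_ge_card G L
  | insert c C hc ih =>
    have hcl := h1 c (by simp)
    have hcL : c ∉ L := disjoint_left.1 hd (by simp)
    apply Gn.split (C1 := {c}) (L1 := {f c}) (a := 0) (b := 0) hd (by simp) (by simpa using hcl.1)
    · unfold Gn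
      have hu : ({c} : Finset V) ∪ {f c} = {c, f c} := rfl
      rw [hu]
      have e1 := sc_ge_card G (({c, f c} : Finset V).erase c)
      have e2 := sc_ge_card G (({c, f c} : Finset V).erase (f c))
      rw [card_erase_of_mem (by simp), card_pair hcl.2.ne] at e1 e2
      apply sc_edge G (u := c) (v := f c) (by simp) (by simp) hcl.2
      · simp only [card_singleton]
        omega
      · simp only [card_singleton]
        omega
    · have : insert c C \ {c} = C := by
        ext x
        simp only [mem_sdiff, mem_insert, mem_singleton]
        constructor
        · tauto
        · intro hx
          refine ⟨Or.inr hx, ?_⟩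
          rintro rfl
          exact hc hx
      rw [this]
      apply ih
      · intro d hd'
        refine ⟨?_, (h1 d (by simp [hd'])).2⟩
        rw [mem_sdiff, mem_singleton]
        refine ⟨(h1 d (by simp [hd'])).1, fun he => ?_⟩
        have := h2 (by simp [hd']) (by simp) he
        subst this
        exact hc hd'
      · exact h2.mono (by simp)
      · exact (hd.mono_left (subset_insert _ _)).mono_right sdiff_subset
    · simp

end
end SlowCol

namespace SlowCol
open Finset

section
set_option linter.unusedSectionVars false
set_option linter.unusedVariables false
variable {V : Type*} [DecidableEq V] {G : SimpleGraph V}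

lemma HC.nbself {j : ℕ} {C L Q : Finset V} (h : HC G j C L) (hQ : Q ⊆ C) : HC G j Q (nb G Q L) := by
  refine ⟨(h.1.mono_left hQ).mono_right (nb_subset _ _), fun R hR hn => ?_⟩
  rw [nb_nb hR]
  exact h.2 R (hR.trans hQ) hn

lemma nb_empty (L : Finset V) : nb G ∅ L = ∅ := by
  ext l
  rw [mem_nb]
  simp

lemma peel {C L : Finset V} (h : HC G 0 C L) :
    ∃ C' ⊆ C, ∃ L' ⊆ L, HC G 1 C' L' ∧ L'.card + C.card = L.card + C'.card ∧
      (∀ l ∈ L', ∀ c ∈ C, G.Adj c l → c ∈ C') ∧ (∀ g, Gn G C' L' g → Gn G C L g) := by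
  classical
  let F := C.powerset.filter (fun Q => (nb G Q L).card = Q.card)
  have hF : F.Nonempty := ⟨∅, by simp only [F, mem_filter, mem_powerset, nb_empty]; simp⟩
  obtain ⟨Q, hQ, hmax⟩ := F.exists_max_image (fun D => D.card) hF
  simp only [F, mem_filter, mem_powerset] at hQ hmax
  obtain ⟨hQC, hQt⟩ := hQ
  have e1 := card_sdiff_add_card_eq_card hQC
  have e2 := card_sdiff_add_card_eq_card (nb_subset (G := G) Q L)
  refine ⟨C \ Q, sdiff_subset, L \ nb G Q L, sdiff_subset, ⟨h.1.mono sdiff_subset sdiff_subset, ?_⟩,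
    by omega, ?_, ?_⟩
  · intro R hR hn
    have hdj : Disjoint Q R := by
      rw [disjoint_left]
      intro x hx hxR
      exact (mem_sdiff.1 (hR hxR)).2 hx
    have hsub : Q ∪ R ⊆ C := union_subset hQC (hR.trans sdiff_subset)
    have h1 := nb_card_rest (G := G) Q R L
    have h2 := h.2 (Q ∪ R) hsub (hn.mono subset_union_right)
    have h3 := card_union_of_disjoint hdj
    have h4 := hn.card_pos
    by_contra hcon
    have := hmax (Q ∪ R) ⟨hsub, by omega⟩
    omega
  · intro l hl c hc ha
    rw [mem_sdiff] at hl ⊢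
    refine ⟨hc, fun hcQ => hl.2 ?_⟩
    exact mem_nb.2 ⟨hl.1, c, hcQ, ha⟩
  · intro g hg
    exact Gn.split h.1 hQC (nb_subset Q L) (Gn.base (h.nbself hQC)) hg (by omega)

/-- critical sets -/
def Crit (G : SimpleGraph V) (C L Q : Finset V) : Prop :=
  Q ⊆ C ∧ Q.Nonempty ∧ (nb G Q L).card = Q.card + 1

lemma Crit.union {C L Q R : Finset V} (h : HC G 1 C L) (hQ : Crit G C L Q) (hR : Crit G C L R)
    (hi : (nb G Q L ∩ nb G R L).Nonempty) : Crit G C L (Q ∪ R) := by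
  refine ⟨union_subset hQ.1 hR.1, hQ.2.1.mono subset_union_left, ?_⟩
  have h1 := nb_card_inter (G := G) Q R L
  have h2 := h.2 (Q ∪ R) (union_subset hQ.1 hR.1) (hQ.2.1.mono subset_union_left)
  have h3 := card_union_add_card_inter Q R
  have h4 := hQ.2.2
  have h5 := hR.2.2
  have h6 := hi.card_pos
  rcases (Q ∩ R).eq_empty_or_nonempty with he | hn
  · rw [he, card_empty] at h3
    omega
  · have h7 := h.2 (Q ∩ R) (inter_subset_left.trans hQ.1) hn
    have h8 : (nb G (Q ∩ R) L).card ≤ (nb G Q L ∩ nb G R L).card :=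
      card_le_card (subset_inter (nb_mono inter_subset_left) (nb_mono inter_subset_right))
    omega

/-- surplus two for all sets containing `z`. -/
def GoodAt (G : SimpleGraph V) (z : V) (C L : Finset V) : Prop :=
  HC G 1 C L ∧ z ∈ C ∧ ∀ Q ⊆ C, z ∈ Q → Q.card + 2 ≤ (nb G Q L).card

lemma GoodAt.mono {z : V} {C C' L : Finset V} (h : GoodAt G z C L) (hs : C' ⊆ C) (hz : z ∈ C') :
    GoodAt G z C' L :=
  ⟨h.1.mono_left hs, hz, fun Q hQ hzQ => h.2.2 Q (hQ.trans hs) hzQ⟩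

lemma erase2_card_le (A : Finset V) (a b : V) : A.card ≤ ((A.erase a).erase b).card + 2 := by
  have := pred_card_le_card_erase (s := A) (a := a)
  have := pred_card_le_card_erase (s := A.erase a) (a := b)
  omega

lemma GoodAt.pair {z : V} {C L : Finset V} (h : GoodAt G z C L) :
    ∃ t ∈ L, ∃ t' ∈ L, t ≠ t' ∧ G.Adj z t ∧ G.Adj z t' ∧ HC G 0 C ((L.erase t).erase t') := by
  classical
  obtain ⟨hH, hz, hzQ⟩ := h
  have h3 := hzQ {z} (by simpa using hz) (by simp)
  rw [card_singleton] at h3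
  obtain ⟨t, ht⟩ : (nb G {z} L).Nonempty := card_pos.1 (by omega)
  -- reduce to finding t' such that no critical set sees both
  have hred : ∀ t' ∈ nb G {z} L, t ≠ t' →
      (∀ Q, Crit G C L Q → t ∈ nb G Q L → t' ∉ nb G Q L) →
      ∃ t ∈ L, ∃ t' ∈ L, t ≠ t' ∧ G.Adj z t ∧ G.Adj z t' ∧
        HC G 0 C ((L.erase t).erase t') := by
    intro t' ht' hne hcr
    have a1 := mem_nb.1 ht
    have a2 := mem_nb.1 ht'
    simp only [mem_singleton, exists_eq_left] at a1 a2
    refine ⟨t, a1.1, t', a2.1, hne, a1.2, a2.2, ?_, ?_⟩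
    · exact hH.1.mono_right ((erase_subset _ _).trans (erase_subset _ _))
    · intro Q hQ hn
      rw [nb_erase, nb_erase]
      have b1 := hH.2 Q hQ hn
      have b2 := erase2_card_le (nb G Q L) t t'
      by_cases hc : (nb G Q L).card = Q.card + 1
      · by_cases htQ : t ∈ nb G Q L
        · have := hcr Q ⟨hQ, hn, hc⟩ htQ
          have h5 : t' ∉ (nb G Q L).erase t := fun h => this (mem_of_mem_erase h)
          rw [erase_eq_of_notMem h5]
          have := pred_card_le_card_erase (s := nb G Q L) (a := t)
          omega
        · rw [erase_eq_of_notMem htQ]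
          have := pred_card_le_card_erase (s := nb G Q L) (a := t')
          omega
      · omega
  by_cases hex : ∃ B, Crit G C L B ∧ t ∈ nb G B L
  · let F := C.powerset.filter (fun Q => Crit G C L Q ∧ t ∈ nb G Q L)
    have hF : F.Nonempty := by
      obtain ⟨B, hB, hB2⟩ := hex
      exact ⟨B, by simp [F, hB, hB2, hB.1]⟩
    obtain ⟨B, hB, hmax⟩ := F.exists_max_image (fun D => D.card) hF
    simp only [F, mem_filter, mem_powerset] at hB hmax
    obtain ⟨_, hBc, htB⟩ := hB
    have hzB : z ∉ B := by
      intro hzB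
      have := hzQ B hBc.1 hzB
      have := hBc.2.2
      omega
    have h4 := hzQ (B ∪ {z}) (union_subset hBc.1 (by simpa using hz)) (by simp)
    have h5 : (nb G {z} L \ nb G B L).Nonempty := by
      rw [← card_pos, ← nb_sdiff]
      have := nb_card_rest (G := G) B {z} L
      have := hBc.2.2
      rw [card_union_of_disjoint (by simpa using hzB), card_singleton] at h4
      omega
    obtain ⟨t', ht'⟩ := h5
    rw [mem_sdiff] at ht'
    apply hred t' ht'.1
    · rintro rfl
      exact ht'.2 htB
    · intro Q hQ htQ ht'Q
      have hU := Crit.union hH hBc hQ ⟨t, mem_inter.2 ⟨htB, htQ⟩⟩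
      have := hmax (B ∪ Q) ⟨hU.1, hU, nb_mono subset_union_left htB⟩
      have hBe : B = B ∪ Q := eq_of_subset_of_card_le subset_union_left this
      have : nb G Q L ⊆ nb G B L := nb_mono (by rw [hBe]; exact subset_union_right)
      exact ht'.2 (this ht'Q)
  · push Not at hex
    obtain ⟨t', ht', hne⟩ := exists_mem_ne (show 1 < (nb G {z} L).card by omega) t
    exact hred t' ht' hne.symm (fun Q hQ htQ => absurd htQ (hex Q hQ))

/-- Not good: there is a closed critical block. -/
lemma dich {C L : Finset V} (h : HC G 1 C L) (hn : C.Nonempty) (hg : ∀ z, ¬ GoodAt G z C L) :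
    ∃ B ⊆ C, B.Nonempty ∧ (nb G B L).card = B.card + 1 ∧ HC G 1 B (nb G B L) ∧
      HC G 1 (C \ B) (L \ nb G B L) ∧
      (∀ c ∈ C, ∀ l ∈ nb G B L, G.Adj c l → c ∈ B) ∧
      (∀ c ∈ C, ∀ l ∈ L \ nb G B L, G.Adj c l → c ∈ C \ B) := by
  classical
  have hcov : ∀ z ∈ C, ∃ Q, Crit G C L Q ∧ z ∈ Q := by
    intro z hz
    have := hg z
    unfold GoodAt at this
    push Not at this
    obtain ⟨Q, hQ, hzQ, hlt⟩ := this h hz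
    have := h.2 Q hQ ⟨z, hzQ⟩
    exact ⟨Q, ⟨hQ, ⟨z, hzQ⟩, by omega⟩, hzQ⟩
  let F := C.powerset.filter (fun Q => Crit G C L Q)
  have hF : F.Nonempty := by
    obtain ⟨z, hz⟩ := hn
    obtain ⟨Q, hQ, _⟩ := hcov z hz
    exact ⟨Q, by simp [F, hQ, hQ.1]⟩
  obtain ⟨B, hB, hmax⟩ := F.exists_max_image (fun D => D.card) hF
  simp only [F, mem_filter, mem_powerset] at hB hmax
  obtain ⟨_, hBc⟩ := hB
  have hcl : ∀ c ∈ C, ∀ l ∈ nb G B L, G.Adj c l → c ∈ B := by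
    intro c hc l hl ha
    obtain ⟨Q, hQ, hcQ⟩ := hcov c hc
    have hU := Crit.union h hBc hQ
      ⟨l, mem_inter.2 ⟨hl, mem_nb.2 ⟨(mem_nb.1 hl).1, c, hcQ, ha⟩⟩⟩
    have := hmax (B ∪ Q) ⟨hU.1, hU⟩
    have hBe : B = B ∪ Q := eq_of_subset_of_card_le subset_union_left this
    rw [hBe]
    exact mem_union_right _ hcQ
  refine ⟨B, hBc.1, hBc.2.1, hBc.2.2, h.nbself hBc.1, ⟨h.1.mono sdiff_subset sdiff_subset, ?_⟩,
    hcl, ?_⟩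
  · intro R hR hRn
    have : nb G R (L \ nb G B L) = nb G R L := by
      rw [nb_sdiff, sdiff_eq_self_of_disjoint]
      rw [disjoint_left]
      intro l hl hlB
      obtain ⟨hlL, r, hr, ha⟩ := mem_nb.1 hl
      have hr' := mem_sdiff.1 (hR hr)
      exact hr'.2 (hcl r hr'.1 l hlB ha)
    rw [this]
    exact h.2 R (hR.trans sdiff_subset) hRn
  · intro c hc l hl ha
    rw [mem_sdiff] at hl ⊢
    refine ⟨hc, fun hcB => hl.2 ?_⟩
    exact mem_nb.2 ⟨hl.1, c, hcB, ha⟩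

lemma NC {C L : Finset V} {c0 : V} (h : HC G 1 C L) (hcard : L.card = C.card + 1) (hc0 : c0 ∈ C)
    (h2 : 2 ≤ C.card) (hl : ∀ s ∈ C, s ≠ c0 → ∀ l ∈ L, ∃ c ∈ C, c ≠ s ∧ G.Adj c l) :
    ∃ s ∈ C, ∃ z, GoodAt G z (C.erase s) L := by
  classical
  by_cases hex : ∃ Q, Crit G C L Q ∧ c0 ∈ Q ∧ Q ≠ C
  · let F := C.powerset.filter (fun Q => Crit G C L Q ∧ c0 ∈ Q ∧ Q ≠ C)
    have hF : F.Nonempty := by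
      obtain ⟨B, hB, hB2⟩ := hex
      exact ⟨B, by simp [F, hB, hB2, hB.1]⟩
    obtain ⟨Q, hQ, hmax⟩ := F.exists_max_image (fun D => D.card) hF
    simp only [F, mem_filter, mem_powerset] at hQ hmax
    obtain ⟨hQC, hQc, hc0Q, hQne⟩ := hQ
    have e1 := card_sdiff_add_card_eq_card hQC
    -- |C \ Q| ≥ 2
    have hR : 1 < (C \ Q).card := by
      have hpos : 0 < (C \ Q).card := by
        rw [card_pos, sdiff_nonempty]
        exact fun hs => hQne (Subset.antisymm hQC hs)
      by_contra hcon
      have h1 : (C \ Q).card = 1 := by omega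
      obtain ⟨s, hs⟩ := card_eq_one.1 h1
      have hsC : s ∈ C \ Q := by rw [hs]; simp
      rw [mem_sdiff] at hsC
      have hsne : s ≠ c0 := by
        rintro rfl
        exact hsC.2 hc0Q
      have hL : L ⊆ nb G Q L := by
        intro l hlL
        obtain ⟨c, hc, hcs, ha⟩ := hl s hsC.1 hsne l hlL
        refine mem_nb.2 ⟨hlL, c, ?_, ha⟩
        by_contra hcQ
        have : c ∈ C \ Q := mem_sdiff.2 ⟨hc, hcQ⟩
        rw [hs, mem_singleton] at this
        exact hcs this
      have := card_le_card hL
      have := hQc.2.2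
      omega
    obtain ⟨s, hs, s', hs', hne⟩ := one_lt_card.1 hR
    have key : ∀ s ∈ C \ Q, (∀ z, ¬ GoodAt G z (C.erase s) L) →
        ∀ r ∈ C \ Q, r ≠ s → ∀ l ∈ nb G Q L, ¬ G.Adj r l := by
      intro s hs hng r hr hrs l hlQ ha
      have hrC : r ∈ C.erase s := mem_erase.2 ⟨hrs, (mem_sdiff.1 hr).1⟩
      have := hng r
      unfold GoodAt at this
      push Not at this
      obtain ⟨Q', hQ', hrQ', hlt⟩ := this (h.mono_left (erase_subset _ _)) hrC
      have hQ'C := hQ'.trans (erase_subset _ _)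
      have h5 := h.2 Q' hQ'C ⟨r, hrQ'⟩
      have hQ'c : Crit G C L Q' := ⟨hQ'C, ⟨r, hrQ'⟩, by omega⟩
      have hU := Crit.union h hQc hQ'c
        ⟨l, mem_inter.2 ⟨hlQ, mem_nb.2 ⟨(mem_nb.1 hlQ).1, r, hrQ', ha⟩⟩⟩
      have hm := hmax (Q ∪ Q') ⟨hU.1, hU, mem_union_left _ hc0Q, by
        intro he
        have : s ∈ Q ∪ Q' := by rw [he]; exact (mem_sdiff.1 hs).1
        rw [mem_union] at this
        rcases this with h6 | h6
        · exact (mem_sdiff.1 hs).2 h6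
        · exact (mem_erase.1 (hQ' h6)).1 rfl⟩
      have hBe : Q = Q ∪ Q' := eq_of_subset_of_card_le subset_union_left hm
      exact (mem_sdiff.1 hr).2 (by rw [hBe]; exact mem_union_right _ hrQ')
    by_contra hcon
    push Not at hcon
    have k1 := key s hs (hcon s (mem_sdiff.1 hs).1)
    have k2 := key s' hs' (hcon s' (mem_sdiff.1 hs').1)
    have hdis : Disjoint (nb G Q L) (nb G (C \ Q) L) := by
      rw [disjoint_left]
      intro l hlQ hlR
      obtain ⟨_, r, hr, ha⟩ := mem_nb.1 hlR
      by_cases hrs : r = s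
      · exact k2 r hr (by rw [hrs]; exact hne) l hlQ ha
      · exact k1 r hr hrs l hlQ ha
    have q1 := h.2 (C \ Q) sdiff_subset (card_pos.1 (by omega))
    have q2 := hQc.2.2
    have q3 := card_union_of_disjoint hdis
    have q4 : (nb G Q L ∪ nb G (C \ Q) L).card ≤ L.card :=
      card_le_card (union_subset (nb_subset _ _) (nb_subset _ _))
    omega
  · push Not at hex
    obtain ⟨s, hs, hne⟩ := exists_mem_ne (show 1 < C.card by omega) c0
    refine ⟨s, hs, c0, h.mono_left (erase_subset _ _), mem_erase.2 ⟨hne.symm, hc0⟩, ?_⟩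
    intro Q hQ hzQ
    have h1 := h.2 Q (hQ.trans (erase_subset _ _)) ⟨c0, hzQ⟩
    by_contra hcon
    have := hex Q ⟨hQ.trans (erase_subset _ _), ⟨c0, hzQ⟩, by omega⟩ hzQ
    subst this
    exact (mem_erase.1 (hQ hs)).1 rfl

end
end SlowCol

namespace SlowCol
open Finset

section
set_option linter.unusedSectionVars false
set_option linter.unusedVariables false
variable {V : Type*} [DecidableEq V] {G : SimpleGraph V}

/-- centre degrees at least `d`. -/
def BetaP (G : SimpleGraph V) (d : ℕ) : Prop :=
  ∀ C L : Finset V, HC G 0 C L → (∀ c ∈ C, d ≤ dg G L c) →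
    Gn G C L (min (C.card - 1) ((d - 1) / 2))

/-- leaf degrees at least `d`. -/
def UP (G : SimpleGraph V) (d : ℕ) : Prop :=
  ∀ C L : Finset V, HC G 0 C L → C.card < L.card → (∀ l ∈ L, d ≤ dg G C l) →
    Gn G C L (d / 2)

lemma dg_nb {Q L : Finset V} {c : V} (hc : c ∈ Q) : dg G L c ≤ dg G (nb G Q L) c :=
  dg_mono (fun l hl ha => mem_nb.2 ⟨hl, c, hc, ha.symm⟩)

lemma exists_leaf {j : ℕ} {C L : Finset V} {c : V} (h : HC G (j + 1) C L) (hc : c ∈ C) :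
    ∃ l ∈ L, G.Adj c l := by
  have := h.2 {c} (by simpa using hc) (by simp)
  obtain ⟨l, hl⟩ : (nb G {c} L).Nonempty := card_pos.1 (by omega)
  rw [mem_nb] at hl
  exact ⟨l, hl.1, by simpa using hl.2⟩

lemma exists_two {L : Finset V} {c : V} (h : 2 ≤ dg G L c) :
    ∃ l ∈ L, ∃ l' ∈ L, l ≠ l' ∧ G.Adj c l ∧ G.Adj c l' := by
  obtain ⟨a, ha, b, hb, hne⟩ := one_lt_card.1 h
  simp only [mem_filter] at ha hb
  exact ⟨a, ha.1, b, hb.1, hne, ha.2.symm, hb.2.symm⟩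

lemma Gn.good_cherry {C L : Finset V} {z : V} {a b g : ℕ} (h : GoodAt G z C L)
    (h1 : ∀ L' ⊆ L, L'.card + 2 = L.card → HC G 0 C L' → Gn G C L' a)
    (h2 : Gn G (C.erase z) L b) (ha : g ≤ a + 1) (hb : g ≤ b + 1) : Gn G C L g := by
  obtain ⟨t, ht, t', ht', hne, hat, hat', hH⟩ := h.pair
  refine Gn.cherry h.1.1 h.2.1 ht ht' hne hat hat' (h1 _ ?_ ?_ hH) h2 ha hb
  · exact (erase_subset _ _).trans (erase_subset _ _)
  · have h3 : t' ∈ L.erase t := mem_erase.2 ⟨hne.symm, ht'⟩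
    have h4 := card_pos.2 ⟨_, h3⟩
    rw [card_erase_of_mem h3]
    rw [card_erase_of_mem ht] at h4 ⊢
    omega

lemma V2 {d : ℕ} (hd : 3 ≤ d) (hB : BetaP G (d - 2)) : ∀ (n : ℕ) (C L : Finset V), C.card = n →
    HC G 2 C L → (∀ c ∈ C, d ≤ dg G L c) → Gn G C L (min C.card ((d - 1) / 2)) := by
  intro n
  induction n with
  | zero =>
    intro C L hC hH _
    exact (Gn.base (hH.weaken (by omega))).weaken (by omega)
  | succ n ih =>
    intro C L hC hH hdeg
    obtain ⟨c, hc⟩ : C.Nonempty := card_pos.1 (by omega)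
    obtain ⟨l, hl, l', hl', hne, ha, ha'⟩ := exists_two (show 2 ≤ dg G L c by
      have := hdeg c hc; omega)
    have e := card_erase_of_mem hc
    have h1 : Gn G C ((L.erase l).erase l') _ := hB C _ ((hH.erase_leaf l).erase_leaf l') (by
      intro x hx
      have := hdeg x hx
      have := dg_erase (G := G) L l x
      have := dg_erase (G := G) (L.erase l) l' x
      omega)
    have h2 := ih (C.erase c) L (by omega) (hH.mono_left (erase_subset _ _))
      (fun x hx => hdeg x (mem_of_mem_erase hx))
    exact Gn.cherry hH.1 hc hl hl' hne ha ha' h1 h2 (by omega) (by omega)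

lemma beta1 {d : ℕ} (hd : 3 ≤ d) (hB2 : BetaP G (d - 2)) (hB1 : BetaP G (d - 1))
    (C L : Finset V) (hH : HC G 1 C L) (hdeg : ∀ c ∈ C, d ≤ dg G L c) :
    Gn G C L (min (C.card - 1) ((d - 1) / 2)) := by
  classical
  by_cases hex : ∃ Q, Crit G C L Q
  · let F := C.powerset.filter (fun Q => Crit G C L Q)
    have hF : F.Nonempty := by
      obtain ⟨Q, hQ⟩ := hex
      exact ⟨Q, by simp [F, hQ, hQ.1]⟩
    obtain ⟨Q, hQ, hmin⟩ := F.exists_min_image (fun D => D.card) hF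
    simp only [F, mem_filter, mem_powerset] at hQ hmin
    obtain ⟨hQC, _, ⟨c, hc⟩, hQc⟩ := hQ
    have hH1 := hH.nbself hQC
    have hdegQ : ∀ x ∈ Q, d ≤ dg G (nb G Q L) x := fun x hx => (hdeg x (hQC hx)).trans (dg_nb hx)
    have hcard : d ≤ (nb G Q L).card := (hdegQ c hc).trans (dg_le_card _ _)
    have hrest : HC G 0 (C \ Q) (L \ nb G Q L) := by
      refine ⟨hH.1.mono sdiff_subset sdiff_subset, fun R hR hn => ?_⟩
      have h1 := nb_card_rest (G := G) Q R L
      have h2 := hH.2 (Q ∪ R) (union_subset hQC (hR.trans sdiff_subset))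
        (hn.mono subset_union_right)
      rw [card_union_of_disjoint (disjoint_sdiff.mono_right hR)] at h2
      omega
    apply Gn.split hH.1 hQC (nb_subset Q L) (a := (d - 1) / 2) ?_ (Gn.base hrest) (by omega)
    obtain ⟨l, hl, ha⟩ := exists_leaf hH1 hc
    have e := card_erase_of_mem hc
    have g1 := hB1 Q ((nb G Q L).erase l) (hH1.erase_leaf l) (by
      intro x hx
      have := hdegQ x hx
      have := dg_erase (G := G) (nb G Q L) l x
      omega)
    have hH2 : HC G 2 (Q.erase c) (nb G Q L) := by
      refine ⟨hH1.1.mono_left (erase_subset _ _), fun R hR hn => ?_⟩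
      have hRQ := hR.trans (erase_subset _ _)
      rw [nb_nb hRQ]
      have h1 := hH.2 R (hRQ.trans hQC) hn
      by_contra hcon
      have := hmin R ⟨hRQ.trans hQC, hRQ.trans hQC, hn, by omega⟩
      have := card_le_card hR
      have := card_pos.2 ⟨c, hc⟩
      omega
    have g2 := V2 hd hB2 _ (Q.erase c) (nb G Q L) rfl hH2
      (fun x hx => hdegQ x (mem_of_mem_erase hx))
    exact Gn.edge hH1.1 hc hl ha g1 (g2.weaken (by omega)) (by omega)
  · have hH2 : HC G 2 C L := by
      refine ⟨hH.1, fun Q hQ hn => ?_⟩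
      have h1 := hH.2 Q hQ hn
      by_contra hcon
      exact hex ⟨Q, hQ, hn, by omega⟩
    exact (V2 hd hB2 _ C L rfl hH2 hdeg).weaken (by omega)

lemma beta_step {d : ℕ} (ih : ∀ e < d, BetaP G e ∧ UP G e) : BetaP G d := by
  classical
  intro C L hH hdeg
  by_cases hd : d ≤ 2
  · exact (Gn.base hH).weaken (by omega)
  have hd3 : 3 ≤ d := by omega
  have hb1 := beta1 hd3 (ih (d - 2) (by omega)).1 (ih (d - 1) (by omega)).1
  by_cases hex : ∃ Q ⊆ C, Q.Nonempty ∧ (nb G Q L).card = Q.card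
  · let F := C.powerset.filter (fun Q => Q.Nonempty ∧ (nb G Q L).card = Q.card)
    have hF : F.Nonempty := by
      obtain ⟨Q, hQ, hQ2⟩ := hex
      exact ⟨Q, by simp [F, hQ, hQ2]⟩
    obtain ⟨T, hT, hmin⟩ := F.exists_min_image (fun D => D.card) hF
    simp only [F, mem_filter, mem_powerset] at hT hmin
    obtain ⟨hTC, ⟨t, ht⟩, hTc⟩ := hT
    have hH1 := hH.nbself hTC
    have hdegQ : ∀ x ∈ T, d ≤ dg G (nb G T L) x := fun x hx => (hdeg x (hTC hx)).trans (dg_nb hx)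
    have hcard : d ≤ (nb G T L).card := (hdegQ t ht).trans (dg_le_card _ _)
    have hrest : HC G 0 (C \ T) (L \ nb G T L) := by
      refine ⟨hH.1.mono sdiff_subset sdiff_subset, fun R hR hn => ?_⟩
      have h1 := nb_card_rest (G := G) T R L
      have h2 := hH.2 (T ∪ R) (union_subset hTC (hR.trans sdiff_subset))
        (hn.mono subset_union_right)
      rw [card_union_of_disjoint (disjoint_sdiff.mono_right hR)] at h2
      omega
    apply Gn.split hH.1 hTC (nb_subset T L) (a := (d - 1) / 2) ?_ (Gn.base hrest) (by omega)
    obtain ⟨s, hs, ha⟩ := dg_pos (show 1 ≤ dg G (nb G T L) t by have := hdegQ t ht; omega)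
    have e := card_erase_of_mem ht
    have e' := card_erase_of_mem hs
    have g1 := (ih (d - 1) (by omega)).2 ((nb G T L).erase s) T
      ((hH1.swap hTc.symm).mono_left (erase_subset _ _)) (by omega) (by
        intro x hx
        have := hdegQ x hx
        have := dg_erase (G := G) (nb G T L) s x
        omega)
    have g1' : Gn G T ((nb G T L).erase s) ((d - 1) / 2 - 1) := by
      unfold Gn at g1 ⊢
      rw [union_comm]
      omega
    have hH2 : HC G 1 (T.erase t) (nb G T L) := by
      refine ⟨hH1.1.mono_left (erase_subset _ _), fun R hR hn => ?_⟩
      have hRQ := hR.trans (erase_subset _ _)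
      rw [nb_nb hRQ]
      have h1 := hH.2 R (hRQ.trans hTC) hn
      by_contra hcon
      have := hmin R ⟨hRQ.trans hTC, hn, by omega⟩
      have := card_le_card hR
      have := card_pos.2 ⟨t, ht⟩
      omega
    have g2 := hb1 (T.erase t) (nb G T L) hH2 (fun x hx => hdegQ x (mem_of_mem_erase hx))
    exact Gn.edge hH1.1 ht hs ha.symm g1' (g2.weaken (by omega)) (by omega)
  · have hH2 : HC G 1 C L := by
      refine ⟨hH.1, fun Q hQ hn => ?_⟩
      have h1 := hH.2 Q hQ hn
      by_contra hcon
      exact hex ⟨Q, hQ, hn, by omega⟩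
    exact hb1 C L hH2 hdeg

lemma beta_swap {d : ℕ} (hB : BetaP G d) {C L : Finset V} (hH : HC G 0 C L) (hc : C.card = L.card)
    (hn : L.Nonempty) (hdeg : ∀ l ∈ L, d ≤ dg G C l) : Gn G C L ((d - 1) / 2) := by
  have h1 := hB L C (hH.swap hc) hdeg
  obtain ⟨l, hl⟩ := hn
  have := hdeg l hl
  have := dg_le_card (G := G) C l
  exact (h1.swap hc.symm).weaken (by omega)

lemma u_step {d : ℕ} (ih : ∀ e < d, BetaP G e ∧ UP G e) (hB : BetaP G d) : UP G d := by
  intro C0 L0 hH0 hlt0 hdeg0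
  by_cases hd : d ≤ 1
  · exact (Gn.base hH0).weaken (by omega)
  obtain ⟨L1, hL1, hc1, hH1⟩ := hH0.drop_to (n := C0.card + 1) (by omega) (by omega)
  apply Gn.leaf ?_ hL1 hH0.1
  obtain ⟨C, hC, L, hL, hH, hcard, hcl, hback⟩ := peel hH1
  apply hback
  have hcard : L.card = C.card + 1 := by omega
  have hdeg : ∀ l ∈ L, d ≤ dg G C l := fun l hl =>
    (hdeg0 l (hL1 (hL hl))).trans (dg_mono (hcl l hl))
  clear hback hcl hH1 hc1 hdeg0 hH0 hlt0
  obtain ⟨l0, hl0⟩ : L.Nonempty := card_pos.1 (by omega)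
  have hCd : d ≤ C.card := (hdeg l0 hl0).trans (dg_le_card _ _)
  obtain ⟨c0, hc0⟩ : C.Nonempty := card_pos.1 (by omega)
  obtain ⟨s, hs, z, hg⟩ := NC hH hcard hc0 (by omega) (by
    intro s hs _ l hl
    obtain ⟨c, hc, ha⟩ := dg_pos (show 1 ≤ dg G (C.erase s) l by
      have := hdeg l hl
      have := dg_erase (G := G) C s l
      omega)
    rw [mem_erase] at hc
    exact ⟨c, hc.2, hc.1, ha⟩)
  obtain ⟨l, hl, ha⟩ := exists_leaf hH hs
  have es := card_erase_of_mem hs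
  have el := card_erase_of_mem hl
  have g1 : Gn G C (L.erase l) ((d - 1) / 2) :=
    beta_swap hB (hH.erase_leaf l) (by omega) (card_pos.1 (by omega))
      (fun x hx => hdeg x (mem_of_mem_erase hx))
  have hdeg' : ∀ l ∈ L, d ≤ dg G (C.erase s) l + 1 := fun l hl =>
    (hdeg l hl).trans (dg_erase _ _ _)
  have ez := card_erase_of_mem hg.2.1
  have g2 : Gn G (C.erase s) L (d / 2) := by
    apply Gn.good_cherry hg (a := (d - 1 - 1) / 2) (b := (d - 2) / 2)
    · intro L' hL' hc' hH'
      apply beta_swap (ih (d - 1) (by omega)).1 hH' (by omega) (card_pos.1 (by omega))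
      intro x hx
      have := hdeg' x (hL' hx)
      omega
    · apply (ih (d - 2) (by omega)).2
      · exact (hg.1.mono_left (erase_subset _ _)).weaken (by omega)
      · omega
      · intro x hx
        have := hdeg' x hx
        have := dg_erase (G := G) (C.erase s) z x
        omega
    · omega
    · omega
  exact Gn.edge hH.1 hs hl ha g1 g2 (by omega)

theorem package (G : SimpleGraph V) (d : ℕ) : BetaP G d ∧ UP G d := by
  induction d using Nat.strong_induction_on with
  | _ d ih =>
    have := beta_step ih
    exact ⟨this, u_step ih this⟩

end
end SlowCol

namespace SlowCol
open Finset

section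
set_option linter.unusedSectionVars false
set_option linter.unusedVariables false
variable {V : Type*} [DecidableEq V] {G : SimpleGraph V}

/-- The subgraph induced on `A` has a perfect matching. -/
def PM (G : SimpleGraph V) (A : Finset V) : Prop :=
  ∃ p : V → V, ∀ v ∈ A, p v ∈ A ∧ G.Adj v (p v) ∧ p (p v) = v

lemma PM.empty : PM G (∅ : Finset V) := ⟨id, by simp⟩

lemma PM.pair {u v : V} (h : G.Adj u v) : PM G {u, v} := by
  refine ⟨fun x => if x = u then v else u, ?_⟩
  intro x hx
  simp only [mem_insert, mem_singleton] at hx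
  rcases hx with rfl | rfl
  · simp [h, h.ne.symm]
  · simp [h.symm, h.ne.symm]

lemma PM.union {A B : Finset V} (hA : PM G A) (hB : PM G B) (hd : Disjoint A B) :
    PM G (A ∪ B) := by
  obtain ⟨p, hp⟩ := hA
  obtain ⟨q, hq⟩ := hB
  refine ⟨fun x => if x ∈ A then p x else q x, ?_⟩
  intro x hx
  by_cases hxA : x ∈ A
  · have := hp x hxA
    simp only [hxA, if_true, this.1]
    exact ⟨mem_union_left _ this.1, this.2.1, this.2.2⟩
  · have hxB : x ∈ B := by
      rw [mem_union] at hx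
      tauto
    have := hq x hxB
    have hn : q x ∉ A := fun h => disjoint_left.1 hd h this.1
    simp only [hxA, if_false, hn]
    exact ⟨mem_union_right _ this.1, this.2.1, this.2.2⟩

lemma PM.partner {A : Finset V} {u : V} (hA : PM G A) (hu : u ∈ A) :
    ∃ w ∈ A, G.Adj u w ∧ PM G (A \ {u, w}) := by
  obtain ⟨p, hp⟩ := hA
  have h1 := hp u hu
  refine ⟨p u, h1.1, h1.2.1, p, ?_⟩
  intro v hv
  simp only [mem_sdiff, mem_insert, mem_singleton, not_or] at hv ⊢
  have h2 := hp v hv.1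
  refine ⟨⟨h2.1, ?_, ?_⟩, h2.2⟩
  · intro h
    apply hv.2.2
    rw [← h, h2.2.2]
  · intro h
    apply hv.2.1
    rw [← h2.2.2, h, h1.2.2]

lemma sc_pair {u v : V} (h : G.Adj u v) : 3 ≤ sc G {u, v} := by
  have e1 := sc_ge_card G (({u, v} : Finset V).erase u)
  have e2 := sc_ge_card G (({u, v} : Finset V).erase v)
  rw [card_erase_of_mem (by simp), card_pair h.ne] at e1 e2
  apply sc_edge G (u := u) (v := v) (by simp) (by simp) h
  · omega
  · omega

lemma pair_subset {A : Finset V} {u v : V} (hu : u ∈ A) (hv : v ∈ A) : ({u, v} : Finset V) ⊆ A := by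
  intro x hx
  simp only [mem_insert, mem_singleton] at hx
  rcases hx with rfl | rfl <;> assumption

lemma pm_base : ∀ (n : ℕ) (A : Finset V), A.card = n → PM G A → 3 * A.card ≤ 2 * sc G A := by
  intro n
  induction n using Nat.strong_induction_on with
  | _ n ih =>
    intro A hA hP
    rcases A.eq_empty_or_nonempty with rfl | ⟨u, hu⟩
    · simp
    obtain ⟨w, hw, ha, hP'⟩ := hP.partner hu
    have hs := pair_subset hu hw
    have e := card_sdiff_add_card_eq_card hs
    rw [card_pair ha.ne] at e
    have h1 := ih _ (by omega) _ rfl hP'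
    have h2 := sc_superadd G (X := {u, w}) (Y := A \ {u, w}) (A := A) disjoint_sdiff
      (union_sdiff_of_subset hs)
    have h3 := sc_pair ha
    omega

/-- bound for graphs with a perfect matching -/
def AP (G : SimpleGraph V) (d : ℕ) : Prop :=
  ∀ A : Finset V, A.Nonempty → PM G A → (∀ v ∈ A, d ≤ dg G A v) →
    3 * A.card + 2 * ((d - 1) / 2) ≤ 2 * sc G A

/-- bound for graphs with a near perfect matching -/
def A1P (G : SimpleGraph V) (d : ℕ) : Prop :=
  ∀ A : Finset V, ∀ r ∈ A, PM G (A.erase r) → (∀ v ∈ A, d ≤ dg G A v) →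
    3 * A.card + 2 * (d / 2) ≤ 2 * sc G A + 1

lemma a_step {d : ℕ} (h : A1P G (d - 1)) : AP G d := by
  intro A hn hP hdeg
  obtain ⟨u, hu⟩ := hn
  have key : ∀ x ∈ A, 3 * (A.card - 1) + 2 * ((d - 1) / 2) ≤ 2 * sc G (A.erase x) + 1 := by
    intro x hx
    obtain ⟨w, hw, ha, hP'⟩ := hP.partner hx
    rw [← card_erase_of_mem hx]
    apply h (A.erase x) w (mem_erase.2 ⟨ha.ne.symm, hw⟩)
    · have : (A.erase x).erase w = A \ {x, w} := by
        ext y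
        simp only [mem_erase, mem_sdiff, mem_insert, mem_singleton]
        tauto
      rwa [this]
    · intro v hv
      have := hdeg v (mem_of_mem_erase hv)
      have := dg_erase (G := G) A x v
      omega
  obtain ⟨w, hw, ha, hP'⟩ := hP.partner hu
  have hpos := card_pos.2 ⟨u, hu⟩
  have k1 := key u hu
  have k2 := key w hw
  have := sc_edge G hu hw ha (c := 2 + min (sc G (A.erase u)) (sc G (A.erase w)))
    (by omega) (by omega)
  omega

lemma a1_grow {d : ℕ} (h : AP G (d - 1)) (A : Finset V) (hdeg : ∀ v ∈ A, d ≤ dg G A v) :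
    ∀ (n : ℕ) (T S : Finset V), (A \ (T ∪ S)).card = n → T ∪ S ⊆ A → T.card = S.card + 1 →
      PM G (A \ (T ∪ S)) → (∀ t ∈ T, PM G ((T ∪ S).erase t)) → HC G 0 S T →
      3 * A.card + 2 * (d / 2) ≤ 2 * sc G A + 1 := by
  intro n
  induction n using Nat.strong_induction_on with
  | _ n ih =>
    intro T S hn hsub hcard hP hmiss hH
    have e1 := card_sdiff_add_card_eq_card hsub
    have hdTS := card_union_of_disjoint hH.1.symm
    by_cases hTT : ∃ t ∈ T, ∃ u ∈ T, G.Adj t u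
    · obtain ⟨t, ht, u, hu, ha⟩ := hTT
      have key : ∀ x ∈ T, ∀ y ∈ T, y ≠ x →
          3 * (A.card - 1) + 2 * ((d - 1 - 1) / 2) ≤ 2 * sc G (A.erase x) := by
        intro x hx y hy hyx
        have hxA := hsub (mem_union_left _ hx)
        have hyA := hsub (mem_union_left _ hy)
        rw [← card_erase_of_mem hxA]
        apply h
        · exact ⟨y, mem_erase.2 ⟨hyx, hyA⟩⟩
        · have := (hmiss x hx).union hP (disjoint_sdiff.mono_left (erase_subset _ _))
          have e : (T ∪ S).erase x ∪ A \ (T ∪ S) = A.erase x := by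
            ext v
            have := @hsub v
            have hxTS : x ∈ T ∪ S := mem_union_left _ hx
            by_cases hvx : v = x
            · subst hvx
              simp [hxTS]
            · simp only [mem_union, mem_erase, mem_sdiff] at this ⊢
              tauto
          rwa [e] at this
        · intro v hv
          have := hdeg v (mem_of_mem_erase hv)
          have := dg_erase (G := G) A x v
          omega
      have k1 := key t ht u hu ha.ne.symm
      have k2 := key u hu t ht ha.ne
      have htA := hsub (mem_union_left _ ht)
      have huA := hsub (mem_union_left _ hu)
      have := sc_edge G htA huA ha (c := 2 + min (sc G (A.erase t)) (sc G (A.erase u)))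
        (by omega) (by omega)
      omega
    by_cases hout : ∃ t ∈ T, ∃ u ∈ A \ (T ∪ S), G.Adj t u
    · obtain ⟨t, ht, u, hu, ha⟩ := hout
      obtain ⟨w, hw, haw, hP'⟩ := hP.partner hu
      have hu' := mem_sdiff.1 hu
      have hw' := mem_sdiff.1 hw
      have huT : u ∉ T := fun h => hu'.2 (mem_union_left _ h)
      have huS : u ∉ S := fun h => hu'.2 (mem_union_right _ h)
      have hwT : w ∉ T := fun h => hw'.2 (mem_union_left _ h)
      have hwS : w ∉ S := fun h => hw'.2 (mem_union_right _ h)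
      have huw := haw.ne
      have htTS : t ∈ T ∪ S := mem_union_left _ ht
      have hset : insert w T ∪ insert u S = (T ∪ S) ∪ {u, w} := by
        ext v
        simp only [mem_union, mem_insert, mem_singleton]
        tauto
      have hdis : Disjoint (T ∪ S) {u, w} := by
        rw [disjoint_left]
        intro v hv hv2
        simp only [mem_insert, mem_singleton] at hv2
        rcases hv2 with rfl | rfl
        · exact hu'.2 hv
        · exact hw'.2 hv
      have hsd : A \ (insert w T ∪ insert u S) = (A \ (T ∪ S)) \ {u, w} := by
        rw [hset, sdiff_sdiff_left]
        rfl
      have hd' : Disjoint (insert u S) (insert w T) := by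
        rw [disjoint_insert_left, disjoint_insert_right, mem_insert]
        exact ⟨fun h => h.elim huw huT, hwS, hH.1⟩
      have hlt : ((A \ (T ∪ S)) \ {u, w}).card < n := by
        have := card_sdiff_add_card_eq_card (pair_subset hu hw)
        rw [card_pair huw] at this
        omega
      refine ih _ hlt (insert w T) (insert u S) (by rw [hsd]) ?_ ?_ (by rwa [hsd]) ?_ ?_
      · rw [hset]
        exact union_subset hsub (pair_subset hu'.1 hw'.1)
      · rw [card_insert_of_notMem huS, card_insert_of_notMem hwT, hcard]
      · intro t' ht'
        rw [hset]
        rw [mem_insert] at ht'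
        rcases ht' with rfl | ht'
        · have e : (T ∪ S ∪ {u, t'}).erase t' = (T ∪ S).erase t ∪ {t, u} := by
            have hTSt : t' ∉ T ∪ S := hw'.2
            ext v
            by_cases hv1 : v = t'
            · subst hv1
              have h1 : v ≠ t := fun h => hwT (h ▸ ht)
              simp only [mem_union, not_or] at hTSt
              simp [h1, hTSt, huw.symm]
            · by_cases hv2 : v = t
              · subst hv2
                simp [hv1, ht]
              · simp only [mem_union, mem_erase, mem_insert, mem_singleton]
                tauto
          rw [e]
          apply (hmiss t ht).union (PM.pair ha)
          rw [disjoint_left]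
          intro v hv hv2
          simp only [mem_insert, mem_singleton] at hv2
          rw [mem_erase] at hv
          rcases hv2 with rfl | rfl
          · exact hv.1 rfl
          · exact hu'.2 hv.2
        · have e : (T ∪ S ∪ {u, w}).erase t' = (T ∪ S).erase t' ∪ {u, w} := by
            rw [erase_union_distrib, erase_eq_of_notMem (s := {u, w})]
            simp only [mem_insert, mem_singleton, not_or]
            exact ⟨fun h => huT (h ▸ ht'), fun h => hwT (h ▸ ht')⟩
          rw [e]
          exact (hmiss t' ht').union (PM.pair haw) (hdis.mono_left (erase_subset _ _))
      · obtain ⟨f, h1, h2⟩ := hall hH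
        have hne : ∀ x ∈ S, x ≠ u := fun x hx h => huS (h ▸ hx)
        refine hall_conv hd' (fun x => if x = u then w else f x) ?_ ?_
        · intro c hc
          rw [mem_insert] at hc
          rcases hc with rfl | hc
          · simp [haw]
          · simp only [hne c hc, if_false]
            exact ⟨mem_insert_of_mem (h1 c hc).1, (h1 c hc).2⟩
        · intro a ha' b hb' hab
          simp only [coe_insert, Set.mem_insert_iff, mem_coe] at ha' hb'
          rcases ha' with rfl | ha' <;> rcases hb' with rfl | hb'
          · rfl
          · simp only [if_true, hne b hb', if_false] at hab
            exact absurd (h1 b hb').1 (hab ▸ hwT)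
          · simp only [if_true, hne a ha', if_false] at hab
            exact absurd (h1 a ha').1 (hab ▸ hwT)
          · simp only [hne a ha', hne b hb', if_false] at hab
            exact h2 ha' hb' hab
    · push Not at hTT hout
      have hU := (package G d).2 S T hH (by omega) (by
        intro l hl
        refine (hdeg l (hsub (mem_union_left _ hl))).trans (dg_mono ?_)
        intro c hc ha
        by_contra hcS
        by_cases hcT : c ∈ T
        · exact hTT l hl c hcT ha.symm
        · exact hout l hl c (by simp [hc, hcS, hcT]) ha.symm)
      unfold Gn at hU
      rw [union_comm] at hU
      have h3 := sc_superadd G (X := T ∪ S) (Y := A \ (T ∪ S)) (A := A) disjoint_sdiff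
        (union_sdiff_of_subset hsub)
      have h4 := pm_base _ _ rfl hP
      omega

lemma a1_step {d : ℕ} (h : AP G (d - 1)) : A1P G d := by
  intro A r hr hP hdeg
  apply a1_grow h A hdeg _ {r} ∅ rfl
  · simpa using hr
  · simp
  · simpa [sdiff_singleton_eq_erase] using hP
  · intro t ht
    rw [mem_singleton] at ht
    subst ht
    simpa using PM.empty
  · refine ⟨by simp, fun Q hQ hn => ?_⟩
    rw [subset_empty] at hQ
    exact absurd hQ hn.ne_empty

theorem a_all (G : SimpleGraph V) (d : ℕ) : AP G d ∧ A1P G d := by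
  have h0 : AP G 0 := fun A _ hP _ => by
    have := pm_base _ A rfl hP
    omega
  induction d with
  | zero => exact ⟨h0, a1_step h0⟩
  | succ d ih => exact ⟨a_step (by simpa using ih.2), a1_step (by simpa using ih.1)⟩

end
end SlowCol

namespace SlowCol
open Finset

section
set_option linter.unusedSectionVars false
set_option linter.unusedVariables false
variable {V : Type*} [DecidableEq V] {G : SimpleGraph V}

lemma Gn.union {C1 C2 L1 L2 C L : Finset V} {a b g : ℕ} (h1 : Gn G C1 L1 a) (h2 : Gn G C2 L2 b)
    (hd : Disjoint C L) (hC : C1 ∪ C2 = C) (hL : L1 ∪ L2 = L)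
    (hCd : Disjoint C1 C2) (hLd : Disjoint L1 L2) (hg : g ≤ a + b) : Gn G C L g := by
  subst hC hL
  have e1 : (C1 ∪ C2) \ C1 = C2 := by
    rw [union_sdiff_left, sdiff_eq_self_of_disjoint hCd.symm]
  have e2 : (L1 ∪ L2) \ L1 = L2 := by
    rw [union_sdiff_left, sdiff_eq_self_of_disjoint hLd.symm]
  exact Gn.split hd subset_union_left subset_union_left h1 (by rwa [e1, e2]) hg

lemma good1 {C L : Finset V} {z : V} (h : GoodAt G z C L) : Gn G C L 1 :=
  Gn.good_cherry h (a := 0) (b := 0) (fun L' _ _ hH => Gn.base hH)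
    (Gn.base ((h.1.mono_left (erase_subset _ _)).weaken (by omega))) (by omega) (by omega)

lemma exists_other {C : Finset V} {l : V} (s : V) (h : 2 ≤ dg G C l) :
    ∃ c ∈ C, c ≠ s ∧ G.Adj c l := by
  obtain ⟨c, hc, ha⟩ := dg_pos (show 1 ≤ dg G (C.erase s) l by
    have := dg_erase (G := G) C s l
    omega)
  rw [mem_erase] at hc
  exact ⟨c, hc.2, hc.1, ha⟩

lemma U1 {C L : Finset V} (l0 : V) (hH : HC G 0 C L) (hlt : C.card < L.card)
    (hd1 : ∀ l ∈ L, 1 ≤ dg G C l) (hd2 : ∀ l ∈ L, l ≠ l0 → 2 ≤ dg G C l) : Gn G C L 1 := by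
  obtain ⟨L1, hL1, hc1, hH1⟩ := hH.drop_to (n := C.card + 1) (by omega) (by omega)
  apply Gn.leaf ?_ hL1 hH.1
  obtain ⟨C', hC, L', hL, hH', hcard, hcl, hback⟩ := peel hH1
  apply hback
  have hcard : L'.card = C'.card + 1 := by omega
  have hd1 : ∀ l ∈ L', 1 ≤ dg G C' l := fun l hl =>
    (hd1 l (hL1 (hL hl))).trans (dg_mono (hcl l hl))
  have hd2 : ∀ l ∈ L', l ≠ l0 → 2 ≤ dg G C' l := fun l hl hne =>
    (hd2 l (hL1 (hL hl)) hne).trans (dg_mono (hcl l hl))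
  clear hback hcl hH1 hc1
  obtain ⟨l, hl⟩ : L'.Nonempty := card_pos.1 (by omega)
  have hC1 : 1 ≤ C'.card := (hd1 l hl).trans (dg_le_card _ _)
  obtain ⟨l', hl', hne'⟩ := exists_mem_ne (show 1 < L'.card by omega) l0
  have hC2 : 2 ≤ C'.card := (hd2 l' hl' hne').trans (dg_le_card _ _)
  obtain ⟨c0, hc0, hcc⟩ : ∃ c0 ∈ C', l0 ∈ L' → G.Adj c0 l0 := by
    by_cases h : l0 ∈ L'
    · obtain ⟨c, hc, ha⟩ := dg_pos (hd1 l0 h)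
      exact ⟨c, hc, fun _ => ha⟩
    · obtain ⟨c, hc⟩ : C'.Nonempty := card_pos.1 (by omega)
      exact ⟨c, hc, fun h' => absurd h' h⟩
  obtain ⟨s, hs, z, hg⟩ := NC hH' hcard hc0 hC2 (by
    intro s hs hsne l hl
    by_cases hll : l = l0
    · subst hll
      exact ⟨c0, hc0, hsne.symm, hcc hl⟩
    · exact exists_other s (hd2 l hl hll))
  obtain ⟨l, hl, ha⟩ := exists_leaf hH' hs
  exact Gn.edge hH'.1 hs hl ha (Gn.base (hH'.erase_leaf l)) (good1 hg) (by omega)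

lemma U1_fail {C L : Finset V} (hH : HC G 0 C L) (hlt : C.card < L.card)
    (hd1 : ∀ l ∈ L, 1 ≤ dg G C l) (hf : ¬ Gn G C L 1) :
    ∃ l ∈ L, ∃ l' ∈ L, l ≠ l' ∧ dg G C l ≤ 1 ∧ dg G C l' ≤ 1 := by
  have key : ∀ x, ∃ l ∈ L, l ≠ x ∧ dg G C l ≤ 1 := by
    intro x
    by_contra hcon
    push Not at hcon
    exact hf (U1 x hH hlt hd1 (fun l hl hne => hcon l hl hne))
  obtain ⟨x, hx⟩ : L.Nonempty := card_pos.1 (by omega)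
  obtain ⟨l, hl, _, h1⟩ := key x
  obtain ⟨l', hl', hne, h2⟩ := key l
  exact ⟨l, hl, l', hl', hne.symm, h1, h2⟩

/-- leaf with at most one neighbour outside `z` -/
lemma adj_z {C B : Finset V} {z l : V} (hcl : ∀ c ∈ C, c ≠ z → G.Adj c l → c ∈ B)
    (h : dg G B l < dg G C l) : G.Adj z l := by
  by_contra hz
  have : dg G C l ≤ dg G B l := dg_mono (by
    intro c hc ha
    apply hcl c hc ?_ ha
    rintro rfl
    exact hz ha)
  omega

set_option maxHeartbeats 1000000 in
lemma U2_end {C L B1 B2 C3 N1 N2 L3 : Finset V} {z l0 l2 l3 : V} (hH : HC G 1 C L)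
    (hcard : L.card = C.card + 3)
    (hd1 : ∀ l ∈ L, 1 ≤ dg G C l) (hd2 : ∀ l ∈ L, l ≠ l0 → 2 ≤ dg G C l)
    (hC : ∀ x, x ∈ C ↔ x = z ∨ x ∈ B1 ∨ x ∈ B2 ∨ x ∈ C3)
    (hL : ∀ x, x ∈ L ↔ x ∈ N1 ∨ x ∈ N2 ∨ x ∈ L3)
    (hz1 : z ∉ B1) (hz2 : z ∉ B2) (hz3 : z ∉ C3)
    (hB12 : Disjoint B1 B2) (hB13 : Disjoint B1 C3) (hB23 : Disjoint B2 C3)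
    (hN12 : Disjoint N1 N2) (hN13 : Disjoint N1 L3) (hN23 : Disjoint N2 L3)
    (hH1 : HC G 1 B1 N1) (hH2 : HC G 1 B2 N2) (hH3 : HC G 1 C3 L3)
    (hc3 : L3.card = C3.card + 2)
    (hcl1 : ∀ l ∈ N1, ∀ c ∈ C, c ≠ z → G.Adj c l → c ∈ B1)
    (hcl3 : ∀ l ∈ L3, ∀ c ∈ C, c ≠ z → G.Adj c l → c ∈ C3)
    (hl0 : l0 ∉ N1) {l1 l1' : V} (hl1 : l1 ∈ N1) (hl1' : l1' ∈ N1) (hne : l1 ≠ l1')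
    (hg1 : dg G B1 l1 ≤ 1) (hg1' : dg G B1 l1' ≤ 1)
    (hl2 : l2 ∈ N2) (hl2z : G.Adj z l2) (hl3 : l3 ∈ L3) (hl3z : G.Adj z l3) :
    Gn G C L 2 := by
  have hN1L : ∀ x ∈ N1, x ∈ L := fun x hx => (hL x).2 (Or.inl hx)
  have hN2L : ∀ x ∈ N2, x ∈ L := fun x hx => (hL x).2 (Or.inr (Or.inl hx))
  have hL3L : ∀ x ∈ L3, x ∈ L := fun x hx => (hL x).2 (Or.inr (Or.inr hx))
  have hB1C : ∀ x ∈ B1, x ∈ C := fun x hx => (hC x).2 (Or.inr (Or.inl hx))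
  have hzC : z ∈ C := (hC z).2 (Or.inl rfl)
  have hz : ∀ l ∈ N1, dg G B1 l ≤ 1 → G.Adj z l := by
    intro l hl hg
    apply adj_z (hcl1 l hl)
    have := hd2 l (hN1L l hl) (fun h => hl0 (h ▸ hl))
    omega
  obtain ⟨c, hcC, hcz, hca⟩ := exists_other z (hd2 l1 (hN1L _ hl1) (fun h => hl0 (h ▸ hl1)))
  have hcB := hcl1 l1 hl1 c hcC hcz hca
  have huniq : ∀ x ∈ B1, G.Adj x l1 → x = c := by
    intro x hx hxa
    unfold dg at hg1
    rw [card_le_one] at hg1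
    exact hg1 x (by simp [hx, hxa]) c (by simp [hcB, hca])
  have e1 := card_erase_of_mem (hN1L _ hl1)
  have g1 : Gn G C (L.erase l1) 1 := U1 l0 (hH.erase_leaf l1) (by omega)
    (fun l hl => hd1 l (mem_of_mem_erase hl)) (fun l hl => hd2 l (mem_of_mem_erase hl))
  refine Gn.edge hH.1 hcC (hN1L _ hl1) hca g1 ?_ (by omega)
  -- three star
  have hl2' : l2 ∉ N1 := fun h => disjoint_left.1 hN12 h hl2
  have h12 : l1 ≠ l2 := fun h => hl2' (h ▸ hl1)
  have h12' : l1' ≠ l2 := fun h => hl2' (h ▸ hl1')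
  have hPc : ({l1, l1', l2} : Finset V).card = 3 := card_eq_three.2 ⟨_, _, _, hne, h12, h12', rfl⟩
  have hdC : Disjoint (C.erase c) L := hH.1.mono_left (erase_subset _ _)
  have hPL : ({l1, l1', l2} : Finset V) ⊆ L := by
    intro x hx
    simp only [mem_insert, mem_singleton] at hx
    rcases hx with rfl | rfl | rfl
    · exact hN1L _ hl1
    · exact hN1L _ hl1'
    · exact hN2L _ hl2
  apply Gn.mark (P := {l1, l1', l2}) (Q := {z}) (a := 1) (b := 0) hdC hPL
    (by simpa using ⟨hcz.symm, hzC⟩) (by simp)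
  · intro p hp q hq
    simp only [mem_insert, mem_singleton] at hp hq
    subst hq
    rcases hp with rfl | rfl | rfl
    · exact (hz _ hl1 hg1).symm
    · exact (hz _ hl1' hg1').symm
    · exact hl2z.symm
  · -- leaves deleted
    have k1 : Gn G (B1.erase c) ((N1.erase l1).erase l1') 0 := by
      apply Gn.base
      refine ⟨(hH1.1.mono_left (erase_subset _ _)).mono_right
        ((erase_subset _ _).trans (erase_subset _ _)), fun Q hQ hn => ?_⟩
      have q1 := hH1.2 Q (hQ.trans (erase_subset _ _)) hn
      rw [nb_erase, nb_erase, erase_eq_of_notMem (a := l1)]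
      · have := pred_card_le_card_erase (s := nb G Q N1) (a := l1')
        omega
      · intro h
        obtain ⟨_, q, hq, hqa⟩ := mem_nb.1 h
        have hq' := mem_erase.1 (hQ hq)
        exact hq'.1 (huniq q hq'.2 hqa)
    have k2 : Gn G B2 (N2.erase l2) 0 := Gn.base (hH2.erase_leaf l2)
    have hCL3 : Disjoint (insert z C3) L3 := by
      apply hH.1.mono
      · intro x hx
        rw [mem_insert] at hx
        rw [hC]
        clear * - hx
        tauto
      · exact hL3L
    have k3 : Gn G (insert z C3) L3 1 := by
      apply U1 l0
      · refine ⟨hCL3, fun Q hQ hn => ?_⟩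
        by_cases hzQ : z ∈ Q
        · have hQ' : Q.erase z ⊆ C3 := by
            intro x hx
            rw [mem_erase] at hx
            have := hQ hx.2
            rw [mem_insert] at this
            exact this.resolve_left hx.1
          have hc := card_erase_of_mem hzQ
          have hpos := card_pos.2 hn
          rcases (Q.erase z).eq_empty_or_nonempty with he | hn'
          · rw [he, card_empty] at hc
            have : 0 < (nb G Q L3).card := card_pos.2 ⟨l3, mem_nb.2 ⟨hl3, z, hzQ, hl3z⟩⟩
            omega
          · have q1 := hH3.2 _ hQ' hn'
            have q2 := card_le_card (nb_mono (G := G) (L := L3) (erase_subset z Q))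
            omega
        · have hQ' : Q ⊆ C3 := by
            intro x hx
            have := hQ hx
            rw [mem_insert] at this
            rcases this with rfl | h
            · exact absurd hx hzQ
            · exact h
          have q1 := hH3.2 _ hQ' hn
          omega
      · rw [card_insert_of_notMem hz3]
        omega
      · intro l hl
        refine (hd1 l (hL3L l hl)).trans (dg_mono ?_)
        intro x hx ha
        rw [mem_insert]
        by_cases hxz : x = z
        · exact Or.inl hxz
        · exact Or.inr (hcl3 l hl x hx hxz ha)
      · intro l hl hne
        refine (hd2 l (hL3L l hl) hne).trans (dg_mono ?_)
        intro x hx ha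
        rw [mem_insert]
        by_cases hxz : x = z
        · exact Or.inl hxz
        · exact Or.inr (hcl3 l hl x hx hxz ha)
    have hdBB : Disjoint (B1.erase c ∪ B2) ((N1.erase l1).erase l1' ∪ N2.erase l2) := by
      apply hH.1.mono
      · intro x hx
        simp only [mem_union, mem_erase] at hx
        rw [hC]
        clear * - hx
        tauto
      · intro x hx
        simp only [mem_union, mem_erase] at hx
        rw [hL]
        clear * - hx
        tauto
    have k12 := Gn.union (g := 0) k1 k2 hdBB rfl rfl
      (hB12.mono_left (erase_subset _ _))
      ((hN12.mono_left ((erase_subset _ _).trans (erase_subset _ _))).mono_right (erase_subset _ _))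
      (by omega)
    have hc2 : c ∉ B2 := fun h => disjoint_left.1 hB12 hcB h
    have hc3' : c ∉ C3 := fun h => disjoint_left.1 hB13 hcB h
    have hn1 : l1 ∉ N2 := fun h => disjoint_left.1 hN12 hl1 h
    have hn2 : l1' ∉ N2 := fun h => disjoint_left.1 hN12 hl1' h
    have hn3 : l1 ∉ L3 := fun h => disjoint_left.1 hN13 hl1 h
    have hn4 : l1' ∉ L3 := fun h => disjoint_left.1 hN13 hl1' h
    have hn5 : l2 ∉ L3 := fun h => disjoint_left.1 hN23 hl2 h
    refine Gn.union k12 k3 (hdC.mono_right sdiff_subset) ?_ ?_ ?_ ?_ (by omega)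
    · ext x
      simp only [mem_union, mem_erase, mem_insert, hC]
      by_cases hx : x = c
      · subst hx
        simp [hc2, hc3', hcz]
      · clear * - hx
        tauto
    · ext x
      simp only [mem_union, mem_erase, mem_insert, mem_singleton, mem_sdiff, hL]
      by_cases hx1 : x = l1
      · subst hx1
        simp [hn1, hn3]
      by_cases hx2 : x = l1'
      · subst hx2
        simp [hn2, hn4]
      by_cases hx3 : x = l2
      · subst hx3
        simp [hn5, hl2']
      clear * - hx1 hx2 hx3
      tauto
    · rw [disjoint_left]
      intro x hx hx2
      simp only [mem_union, mem_erase, mem_insert] at hx hx2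
      rcases hx2 with rfl | hx2
      · rcases hx with hx | hx
        · exact hz1 hx.2
        · exact hz2 hx
      · rcases hx with hx | hx
        · exact disjoint_left.1 hB13 hx.2 hx2
        · exact disjoint_left.1 hB23 hx hx2
    · rw [disjoint_left]
      intro x hx hx2
      simp only [mem_union, mem_erase] at hx
      rcases hx with hx | hx
      · exact disjoint_left.1 hN13 hx.2.2 hx2
      · exact disjoint_left.1 hN23 hx.2 hx2
  · apply Gn.base
    exact (hH.mono_left (sdiff_subset.trans (erase_subset _ _))).weaken (by omega)
  · simp
  · rw [hPc]
    simp

end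
end SlowCol

namespace SlowCol
open Finset

section
set_option linter.unusedSectionVars false
set_option linter.unusedVariables false
variable {V : Type*} [DecidableEq V] {G : SimpleGraph V}

lemma U2_good {C L : Finset V} {z l0 : V} (hg : GoodAt G z C L) (hcard : L.card = C.card + 3)
    (hd1 : ∀ l ∈ L, 1 ≤ dg G C l) (hd2 : ∀ l ∈ L, l ≠ l0 → 2 ≤ dg G C l) : Gn G C L 2 := by
  have hH := hg.1
  have hzC := hg.2.1
  by_cases hf : Gn G (C.erase z) L 1
  · exact Gn.good_cherry hg (a := 1) (b := 1) (fun L' hL' hc hH' => U1 l0 hH' (by omega)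
      (fun l hl => hd1 l (hL' hl)) (fun l hl => hd2 l (hL' hl))) hf (by omega) (by omega)
  have hH1 : HC G 1 (C.erase z) L := hH.mono_left (erase_subset _ _)
  have hcC1 := card_erase_of_mem hzC
  have hcCpos := card_pos.2 ⟨z, hzC⟩
  have hn1 : (C.erase z).Nonempty := by
    obtain ⟨l, hl, hne⟩ := exists_mem_ne (show 1 < L.card by omega) l0
    obtain ⟨c, hc, hcz, _⟩ := exists_other z (hd2 l hl hne)
    exact ⟨c, mem_erase.2 ⟨hcz, hc⟩⟩
  obtain ⟨B1, hB1, hB1n, hB1c, hHB1, hHC2, cl1, cl2⟩ := dich hH1 hn1 (fun x hx => hf (good1 hx))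
  set N1 := nb G B1 L with hN1
  have hN1L : N1 ⊆ L := nb_subset _ _
  have eC2 := card_sdiff_add_card_eq_card hB1
  have eL2 := card_sdiff_add_card_eq_card hN1L
  set C2 := C.erase z \ B1 with hC2
  set L2 := L \ N1 with hL2
  have f1 : ¬ Gn G B1 N1 1 := fun h => hf (Gn.split hH1.1 hB1 hN1L h
    (Gn.base (hHC2.weaken (by omega))) (by omega))
  have f2 : ¬ Gn G C2 L2 1 := fun h => hf (Gn.split hH1.1 hB1 hN1L
    (Gn.base (hHB1.weaken (by omega))) h (by omega))
  have hn2 : C2.Nonempty := by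
    obtain ⟨l, hl, hne⟩ := exists_mem_ne (show 1 < L2.card by omega) l0
    obtain ⟨c, hc, hcz, hca⟩ := exists_other z (hd2 l (sdiff_subset hl) hne)
    exact ⟨c, cl2 c (mem_erase.2 ⟨hcz, hc⟩) l hl hca⟩
  obtain ⟨B2, hB2, hB2n, hB2c, hHB2, hHC3, cl3, cl4⟩ := dich hHC2 hn2 (fun x hx => f2 (good1 hx))
  set N2 := nb G B2 L2 with hN2
  have hN2L : N2 ⊆ L2 := nb_subset _ _
  have eC3 := card_sdiff_add_card_eq_card hB2
  have eL3 := card_sdiff_add_card_eq_card hN2L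
  set C3 := C2 \ B2 with hC3
  set L3 := L2 \ N2 with hL3
  have f3 : ¬ Gn G B2 N2 1 := fun h => f2 (Gn.split hHC2.1 hB2 hN2L h
    (Gn.base (hHC3.weaken (by omega))) (by omega))
  have f4 : ¬ Gn G C3 L3 1 := fun h => f2 (Gn.split hHC2.1 hB2 hN2L
    (Gn.base (hHB2.weaken (by omega))) h (by omega))
  have hcl1 : ∀ l ∈ N1, ∀ c ∈ C, c ≠ z → G.Adj c l → c ∈ B1 := fun l hl c hc hcz ha =>
    cl1 c (mem_erase.2 ⟨hcz, hc⟩) l hl ha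
  have hcl2 : ∀ l ∈ N2, ∀ c ∈ C, c ≠ z → G.Adj c l → c ∈ B2 := fun l hl c hc hcz ha =>
    cl3 c (cl2 c (mem_erase.2 ⟨hcz, hc⟩) l (hN2L hl) ha) l hl ha
  have hcl3 : ∀ l ∈ L3, ∀ c ∈ C, c ≠ z → G.Adj c l → c ∈ C3 := fun l hl c hc hcz ha =>
    cl4 c (cl2 c (mem_erase.2 ⟨hcz, hc⟩) l (sdiff_subset hl) ha) l hl ha
  have hN2L' : N2 ⊆ L := hN2L.trans sdiff_subset
  have hL3L' : L3 ⊆ L := sdiff_subset.trans sdiff_subset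
  obtain ⟨l1, hl1, l1', hl1', hne1, hg1, hg1'⟩ := U1_fail (hHB1.weaken (by omega)) (by omega)
    (fun l hl => by
      obtain ⟨_, c, hc, ha⟩ := mem_nb.1 hl
      exact dg_pos' hc ha) f1
  obtain ⟨l2, hl2, l2', hl2', hne2, hg2, hg2'⟩ := U1_fail (hHB2.weaken (by omega)) (by omega)
    (fun l hl => by
      obtain ⟨_, c, hc, ha⟩ := mem_nb.1 hl
      exact dg_pos' hc ha) f3
  obtain ⟨l3, hl3, hl3z⟩ : ∃ l3 ∈ L3, G.Adj z l3 := by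
    by_contra hcon
    push Not at hcon
    have hle : ∀ l ∈ L3, dg G C l ≤ dg G C3 l := fun l hl => by
      by_contra hlt
      exact hcon l hl (adj_z (hcl3 l hl) (by omega))
    exact f4 (U1 l0 (hHC3.weaken (by omega)) (by omega)
      (fun l hl => (hd1 l (hL3L' hl)).trans (hle l hl))
      (fun l hl hne => (hd2 l (hL3L' hl) hne).trans (hle l hl)))
  have hC : ∀ x, x ∈ C ↔ x = z ∨ x ∈ B1 ∨ x ∈ B2 ∨ x ∈ C3 := by
    intro x
    have h1 : x ∈ B1 → x ∈ C.erase z := fun h => hB1 h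
    have h2 : x ∈ B2 → x ∈ C2 := fun h => hB2 h
    have h3 : x = z → x ∈ C := by rintro rfl; exact hzC
    simp only [hC3, hC2, mem_sdiff, mem_erase] at h1 h2 ⊢
    clear * - h1 h2 h3
    tauto
  have hL : ∀ x, x ∈ L ↔ x ∈ N1 ∨ x ∈ N2 ∨ x ∈ L3 := by
    intro x
    have h1 : x ∈ N1 → x ∈ L := fun h => hN1L h
    have h2 : x ∈ N2 → x ∈ L2 := fun h => hN2L h
    simp only [hL3, hL2, mem_sdiff] at h1 h2 ⊢
    clear * - h1 h2
    tauto
  have hz1 : z ∉ B1 := fun h => by simpa using hB1 h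
  have hz2' : z ∉ C2 := fun h => by
    have := sdiff_subset h
    simp at this
  have hz2 : z ∉ B2 := fun h => hz2' (hB2 h)
  have hz3 : z ∉ C3 := fun h => hz2' (sdiff_subset h)
  have d12 : Disjoint B1 B2 := disjoint_sdiff.mono_right hB2
  have d13 : Disjoint B1 C3 := disjoint_sdiff.mono_right sdiff_subset
  have d23 : Disjoint B2 C3 := disjoint_sdiff
  have e12 : Disjoint N1 N2 := disjoint_sdiff.mono_right hN2L
  have e13 : Disjoint N1 L3 := disjoint_sdiff.mono_right sdiff_subset
  have e23 : Disjoint N2 L3 := disjoint_sdiff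
  have low1 : ∀ l ∈ N1, l ≠ l0 → dg G B1 l ≤ 1 → G.Adj z l := fun l hl hne hg =>
    adj_z (hcl1 l hl) (by have := hd2 l (hN1L hl) hne; omega)
  have low2 : ∀ l ∈ N2, l ≠ l0 → dg G B2 l ≤ 1 → G.Adj z l := fun l hl hne hg =>
    adj_z (hcl2 l hl) (by have := hd2 l (hN2L' hl) hne; omega)
  by_cases h0 : l0 ∈ N1
  · have h0' : l0 ∉ N2 := fun h => disjoint_left.1 e12 h0 h
    obtain ⟨m, hm, hmz⟩ : ∃ m ∈ N1, G.Adj z m := by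
      by_cases h : l1 = l0
      · exact ⟨l1', hl1', low1 _ hl1' (fun h' => hne1 (h.trans h'.symm)) hg1'⟩
      · exact ⟨l1, hl1, low1 _ hl1 h hg1⟩
    have hC' : ∀ x, x ∈ C ↔ x = z ∨ x ∈ B2 ∨ x ∈ B1 ∨ x ∈ C3 := by
      intro x
      rw [hC x]
      clear * -
      tauto
    have hL' : ∀ x, x ∈ L ↔ x ∈ N2 ∨ x ∈ N1 ∨ x ∈ L3 := by
      intro x
      rw [hL x]
      clear * -
      tauto
    exact U2_end hH hcard hd1 hd2 hC' hL' hz2 hz1 hz3 d12.symm d23 d13 e12.symm e23 e13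
      hHB2 hHB1 hHC3 (by omega) hcl2 hcl3 h0' hl2 hl2' hne2 hg2 hg2' hm hmz hl3 hl3z
  · obtain ⟨m, hm, hmz⟩ : ∃ m ∈ N2, G.Adj z m := by
      by_cases h : l2 = l0
      · exact ⟨l2', hl2', low2 _ hl2' (fun h' => hne2 (h.trans h'.symm)) hg2'⟩
      · exact ⟨l2, hl2, low2 _ hl2 h hg2⟩
    exact U2_end hH hcard hd1 hd2 hC hL hz1 hz2 hz3 d12 d13 d23 e12 e13 e23
      hHB1 hHB2 hHC3 (by omega) hcl1 hcl3 h0 hl1 hl1' hne1 hg1 hg1' hm hmz hl3 hl3z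

lemma U2 {C L : Finset V} (l0 : V) (hH : HC G 0 C L) (hlt : C.card + 3 ≤ L.card)
    (hd1 : ∀ l ∈ L, 1 ≤ dg G C l) (hd2 : ∀ l ∈ L, l ≠ l0 → 2 ≤ dg G C l) : Gn G C L 2 := by
  obtain ⟨L1, hL1, hc1, hH1⟩ := hH.drop_to (n := C.card + 3) (by omega) (by omega)
  apply Gn.leaf ?_ hL1 hH.1
  obtain ⟨C', hC, L', hL, hH', hcard, hcl, hback⟩ := peel hH1
  apply hback
  have hcard : L'.card = C'.card + 3 := by omega
  have hd1 : ∀ l ∈ L', 1 ≤ dg G C' l := fun l hl =>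
    (hd1 l (hL1 (hL hl))).trans (dg_mono (hcl l hl))
  have hd2 : ∀ l ∈ L', l ≠ l0 → 2 ≤ dg G C' l := fun l hl hne =>
    (hd2 l (hL1 (hL hl)) hne).trans (dg_mono (hcl l hl))
  clear hback hcl hH1 hc1
  by_cases hg : ∃ z, GoodAt G z C' L'
  · obtain ⟨z, hz⟩ := hg
    exact U2_good hz hcard hd1 hd2
  push Not at hg
  obtain ⟨l, hl⟩ : L'.Nonempty := card_pos.1 (by omega)
  obtain ⟨c, hc, _⟩ := dg_pos (hd1 l hl)
  obtain ⟨B, hB, hBn, hBc, hHB, hHR, cl1, cl2⟩ := dich hH' ⟨c, hc⟩ hg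
  have e1 := card_sdiff_add_card_eq_card hB
  have hN : nb G B L' ⊆ L' := nb_subset _ _
  have e2 := card_sdiff_add_card_eq_card hN
  refine Gn.split (a := 1) (b := 1) hH'.1 hB hN (U1 l0 (hHB.weaken (by omega)) (by omega) ?_ ?_)
    (U1 l0 (hHR.weaken (by omega)) (by omega) ?_ ?_) (by omega)
  · exact fun l hl => (hd1 l (hN hl)).trans (dg_mono (fun c hc ha => cl1 c hc l hl ha))
  · exact fun l hl hne => (hd2 l (hN hl) hne).trans (dg_mono (fun c hc ha => cl1 c hc l hl ha))
  · exact fun l hl => (hd1 l (sdiff_subset hl)).trans (dg_mono (fun c hc ha => cl2 c hc l hl ha))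
  · exact fun l hl hne => (hd2 l (sdiff_subset hl) hne).trans
      (dg_mono (fun c hc ha => cl2 c hc l hl ha))

end
end SlowCol

namespace SlowCol
open Finset

section
set_option linter.unusedSectionVars false
set_option linter.unusedVariables false
variable {V : Type*} [DecidableEq V] {G : SimpleGraph V}

lemma dg_full {C : Finset V} {l : V} (h : C.card ≤ dg G C l) : ∀ c ∈ C, G.Adj c l := by
  classical
  intro c hc
  unfold dg at h
  have := eq_of_subset_of_card_le (filter_subset _ _) h
  rw [← this] at hc
  exact (mem_filter.1 hc).2

lemma dg_erase_adj {C : Finset V} {s l : V} (hs : s ∈ C) (ha : G.Adj s l) :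
    dg G (C.erase s) l + 1 = dg G C l := by
  classical
  unfold dg
  rw [filter_erase, card_erase_of_mem (by simp [hs, ha])]
  have : 0 < (C.filter (fun c => G.Adj c l)).card := card_pos.2 ⟨s, by simp [hs, ha]⟩
  convert Nat.sub_add_cancel this

/-- complete to a set of leaves gives the Hall condition -/
lemma HC.of_full {j : ℕ} {C L K : Finset V} (hd : Disjoint C L) (hK : K ⊆ L)
    (hf : ∀ l ∈ K, ∀ c ∈ C, G.Adj c l) (hc : C.card + j ≤ K.card) : HC G j C L := by
  refine ⟨hd, fun Q hQ hn => ?_⟩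
  obtain ⟨q, hq⟩ := hn
  have h1 : K ⊆ nb G Q L := fun l hl => mem_nb.2 ⟨hK hl, q, hq, hf l hl q (hQ hq)⟩
  have := card_le_card h1
  have := card_le_card hQ
  omega

lemma GoodAt.of_full {C L K : Finset V} {z : V} (hd : Disjoint C L) (hz : z ∈ C) (hK : K ⊆ L)
    (hf : ∀ l ∈ K, ∀ c ∈ C, G.Adj c l) (hc : C.card + 2 ≤ K.card) : GoodAt G z C L := by
  have := HC.of_full (j := 2) hd hK hf hc
  exact ⟨this.weaken (by omega), hz, fun Q hQ hzQ => this.2 Q hQ ⟨z, hzQ⟩⟩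

lemma U2b {C L K : Finset V} (hd : Disjoint C L) (hC : C.card = 2) (hL : L.card = 5)
    (hd1 : ∀ l ∈ L, 1 ≤ dg G C l) (hK : K ⊆ L) (hKc : K.card = 3)
    (hd2 : ∀ l ∈ K, 2 ≤ dg G C l) : Gn G C L 2 := by
  have e1 := card_sdiff_add_card_eq_card hK
  obtain ⟨p, p', hpp, hLK⟩ := card_eq_two.1 (show (L \ K).card = 2 by omega)
  have hp : p ∈ L \ K := by rw [hLK]; simp
  have hLK' : ∀ l ∈ L, l ∉ K → l = p ∨ l = p' := fun l hl hn => by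
    have : l ∈ L \ K := mem_sdiff.2 ⟨hl, hn⟩
    rw [hLK] at this
    simpa using this
  rw [mem_sdiff] at hp
  have hfull : ∀ l ∈ K, ∀ c ∈ C, G.Adj c l := fun l hl => dg_full (by
    have := hd2 l hl
    omega)
  obtain ⟨x, hx, hxp⟩ := dg_pos (hd1 p hp.1)
  obtain ⟨k, hk⟩ : K.Nonempty := card_pos.1 (by omega)
  have hpk : p ≠ k := fun h => hp.2 (h ▸ hk)
  have hkc := card_erase_of_mem hk
  have hsub : K.erase k ⊆ (L.erase p).erase k := by
    intro l hl
    rw [mem_erase] at hl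
    rw [mem_erase, mem_erase]
    exact ⟨hl.1, fun h => hp.2 (h ▸ hl.2), hK hl.2⟩
  have hLc : ((L.erase p).erase k).card = 3 := by
    rw [card_erase_of_mem (mem_erase.2 ⟨hpk.symm, hK hk⟩), card_erase_of_mem hp.1]
    omega
  have hLs : (L.erase p).erase k ⊆ L := (erase_subset _ _).trans (erase_subset _ _)
  refine Gn.cherry (a := 1) (b := 1) hd hx hp.1 (hK hk) hpk hxp (hfull k hk x hx) ?_ ?_
    (by omega) (by omega)
  · apply U1 p'
    · exact HC.of_full (K := K.erase k) (hd.mono_right hLs) hsub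
        (fun l hl => hfull l (mem_of_mem_erase hl)) (by omega)
    · omega
    · exact fun l hl => hd1 l (hLs hl)
    · intro l hl hne
      apply hd2
      by_contra hn
      rcases hLK' l (hLs hl) hn with h | h
      · rw [mem_erase, mem_erase] at hl
        exact hl.2.1 h
      · exact hne h
  · have hxc := card_erase_of_mem hx
    obtain ⟨y, hy⟩ : (C.erase x).Nonempty := card_pos.1 (by omega)
    exact good1 (GoodAt.of_full (K := K) (hd.mono_left (erase_subset _ _)) hy hK
      (fun l hl c hc => hfull l hl c (mem_of_mem_erase hc)) (by omega))

lemma F23 {C L : Finset V} (hH : HC G 0 C L) (hlt : C.card + 2 ≤ L.card)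
    (hd : ∀ l ∈ L, 3 ≤ dg G C l) : Gn G C L 2 := by
  obtain ⟨L1, hL1, hc1, hH1⟩ := hH.drop_to (n := C.card + 2) (by omega) (by omega)
  apply Gn.leaf ?_ hL1 hH.1
  obtain ⟨C', hC, L', hL, hH', hcard, hcl, hback⟩ := peel hH1
  apply hback
  have hcard : L'.card = C'.card + 2 := by omega
  have hd : ∀ l ∈ L', 3 ≤ dg G C' l := fun l hl =>
    (hd l (hL1 (hL hl))).trans (dg_mono (hcl l hl))
  clear hback hcl hH1 hc1
  obtain ⟨l, hl⟩ : L'.Nonempty := card_pos.1 (by omega)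
  obtain ⟨c, hc, ha⟩ := dg_pos (show 1 ≤ dg G C' l from le_trans (by omega) (hd l hl))
  have e1 := card_erase_of_mem hl
  have e2 := card_erase_of_mem hc
  have e3 := card_pos.2 ⟨c, hc⟩
  have hd2 : ∀ l ∈ L', 2 ≤ dg G (C'.erase c) l := fun l hl => by
    have := dg_erase (G := G) C' c l
    have := hd l hl
    omega
  refine Gn.edge (a := 1) hH'.1 hc hl ha ?_ ?_ (by omega)
  · exact (package G 3).2 _ _ (hH'.erase_leaf l) (by omega) (fun l hl => hd l (mem_of_mem_erase hl))
  · exact U2 l ((hH'.mono_left (erase_subset _ _)).weaken (by omega)) (by omega)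
      (fun l hl => le_trans (by omega) (hd2 l hl)) (fun l hl _ => hd2 l hl)

lemma avg {C W : Finset V} (m k : ℕ) (h : ∀ l ∈ W, dg G C l ≤ m)
    (hlt : m * W.card < (k + 1) * C.card) : ∃ c ∈ C, dg G W c ≤ k := by
  classical
  by_contra hcon
  push Not at hcon
  have h1 := Finset.sum_card_bipartiteAbove_eq_sum_card_bipartiteBelow (s := C) (t := W)
    (fun c l => G.Adj c l)
  have h2 : C.card * (k + 1) ≤ ∑ c ∈ C, (W.bipartiteAbove (fun c l => G.Adj c l) c).card := by
    rw [← smul_eq_mul, ← sum_const]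
    apply sum_le_sum
    intro c hc
    refine (hcon c hc).trans_eq ?_
    unfold dg bipartiteAbove
    congr 1
    ext l
    simp [G.adj_comm]
  have h3 : ∑ l ∈ W, (C.bipartiteBelow (fun c l => G.Adj c l) l).card ≤ W.card * m := by
    rw [← smul_eq_mul, ← sum_const]
    apply sum_le_sum
    intro l hl
    refine le_trans (le_of_eq ?_) (h l hl)
    unfold dg bipartiteBelow
    congr
  nlinarith

lemma N1aux {C L : Finset V} {s c : V} (hH : HC G 1 C L) (hcard : L.card = C.card + 1)
    (hd : ∀ l ∈ L, 3 ≤ dg G C l) (hs : s ∈ C) (hc : c ∈ C.erase s)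
    (h : Gn G ((C.erase s).erase c) L 2) : Gn G C L 2 := by
  have e1 := card_erase_of_mem hs
  have e2 := card_pos.2 ⟨s, hs⟩
  obtain ⟨l, hl, ha⟩ := exists_leaf hH hs
  have el := card_erase_of_mem hl
  refine Gn.edge (a := 1) hH.1 hs hl ha ?_ ?_ (by omega)
  · exact beta_swap (package G 3).1 (hH.erase_leaf l) (by omega) (card_pos.1 (by omega))
      (fun l hl => hd l (mem_of_mem_erase hl))
  · have hH1 : HC G 1 (C.erase s) L := hH.mono_left (erase_subset _ _)
    obtain ⟨l', hl', ha'⟩ := exists_leaf hH1 hc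
    have el' := card_erase_of_mem hl'
    refine Gn.edge (a := 1) hH1.1 hc hl' ha' ?_ h (by omega)
    refine (package G 2).2 _ _ (hH1.erase_leaf l') (by omega) (fun l hl => ?_)
    have := hd l (mem_of_mem_erase hl)
    have := dg_erase (G := G) C s l
    omega

lemma N1 {C L : Finset V} (hH : HC G 1 C L) (hcard : L.card = C.card + 1)
    (hd : ∀ l ∈ L, 3 ≤ dg G C l) (h4 : 4 ≤ C.card) : Gn G C L 2 := by
  classical
  have hDc := card_filter_le L (fun l => dg G C l ≤ 3)
  set D := L.filter (fun l => dg G C l ≤ 3) with hD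
  obtain ⟨s, hs, hsD⟩ := avg (G := G) (C := C) (W := D) 3 3
    (fun l hl => (mem_filter.1 hl).2) (by omega)
  set W := D.filter (fun l => G.Adj l s) with hW
  have hWc : W.card ≤ 3 := by
    refine le_trans (le_of_eq ?_) hsD
    unfold dg
    congr
  have e1 := card_erase_of_mem hs
  have hW2 : ∀ l ∈ W, dg G (C.erase s) l ≤ 2 := by
    intro l hl
    rw [hW, mem_filter, hD, mem_filter] at hl
    have := dg_erase_adj hs hl.2.symm
    omega
  have low1 : ∀ c, ∀ l ∈ L, 1 ≤ dg G ((C.erase s).erase c) l := by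
    intro c l hl
    have := hd l hl
    have := dg_erase (G := G) C s l
    have := dg_erase (G := G) (C.erase s) c l
    omega
  have low2 : ∀ c, ∀ l ∈ L, l ∉ W.filter (fun l => G.Adj l c) →
      2 ≤ dg G ((C.erase s).erase c) l := by
    intro c l hl hlW
    have h1 := hd l hl
    have h2 := dg_erase (G := G) C s l
    have h3 := dg_erase (G := G) (C.erase s) c l
    by_contra hcon
    apply hlW
    have as : G.Adj s l := by
      by_contra hn
      have := dg_erase_of_not_adj (G := G) C hn
      omega
    have ac : G.Adj c l := by
      by_contra hn
      have := dg_erase_of_not_adj (G := G) (C.erase s) hn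
      omega
    rw [mem_filter, hW, mem_filter, hD, mem_filter]
    exact ⟨⟨⟨hl, by omega⟩, as.symm⟩, ac.symm⟩
  by_cases h5 : 5 ≤ C.card
  · obtain ⟨c, hc, hcW⟩ := avg (G := G) (C := C.erase s) (W := W) 2 1 hW2 (by omega)
    have hbc : (W.filter (fun l => G.Adj l c)).card ≤ 1 := by
      refine le_trans (le_of_eq ?_) hcW
      unfold dg
      congr
    apply N1aux hH hcard hd hs hc
    have e2 := card_erase_of_mem hc
    obtain ⟨l0, hl0⟩ : ∃ l0, ∀ l ∈ W.filter (fun l => G.Adj l c), l = l0 := by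
      rcases (W.filter (fun l => G.Adj l c)).eq_empty_or_nonempty with he | ⟨x, hx⟩
      · exact ⟨s, by rw [he]; simp⟩
      · exact ⟨x, fun l hl => card_le_one.1 hbc l hl x hx⟩
    exact U2 l0 ((hH.mono_left ((erase_subset _ _).trans (erase_subset _ _))).weaken (by omega))
      (by omega) (low1 c) (fun l hl hne => low2 c l hl (fun h => hne (hl0 l h)))
  · obtain ⟨c, hc, hcW⟩ := avg (G := G) (C := C.erase s) (W := W) 2 2 hW2 (by omega)
    have hbc : (W.filter (fun l => G.Adj l c)).card ≤ 2 := by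
      refine le_trans (le_of_eq ?_) hcW
      unfold dg
      congr
    apply N1aux hH hcard hd hs hc
    have e2 := card_erase_of_mem hc
    have e3 := le_card_sdiff (W.filter (fun l => G.Adj l c)) L
    obtain ⟨K, hK, hKc⟩ := exists_subset_card_eq
      (show 3 ≤ (L \ W.filter (fun l => G.Adj l c)).card by omega)
    exact U2b (hH.1.mono_left ((erase_subset _ _).trans (erase_subset _ _))) (by omega) (by omega)
      (low1 c) (hK.trans sdiff_subset) hKc
      (fun l hl => low2 c l (sdiff_subset (hK hl)) (mem_sdiff.1 (hK hl)).2)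

lemma Y3 {C L : Finset V} (hd : Disjoint C L) (hC : C.card = 3) (hL : L.card = 6)
    (hdeg : ∀ l ∈ L, 3 ≤ dg G C l) : Gn G C L 3 := by
  have hfull : ∀ l ∈ L, ∀ c ∈ C, G.Adj c l := fun l hl => dg_full (by
    have := hdeg l hl
    omega)
  obtain ⟨P, hP, hPc⟩ := exists_subset_card_eq (show 3 ≤ L.card by omega)
  obtain ⟨Q, hQ, hQc⟩ := exists_subset_card_eq (show 2 ≤ C.card by omega)
  have e1 := card_sdiff_add_card_eq_card hP
  have e2 := card_sdiff_add_card_eq_card hQ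
  have hPn : P.Nonempty := card_pos.1 (by omega)
  refine Gn.mark (a := 1) (b := 2) hd hP hQ hPn
    (fun p hp q hq => (hfull p (hP hp) q (hQ hq)).symm) ?_ ?_ (by omega) (by omega)
  · exact beta_swap (package G 3).1 (HC.of_full (K := L \ P) (hd.mono_right sdiff_subset)
      Subset.rfl (fun l hl => hfull l (sdiff_subset hl)) (by omega)) (by omega)
      (card_pos.1 (by omega)) (fun l hl => hdeg l (sdiff_subset hl))
  · have hd' : Disjoint (C \ Q) L := hd.mono_left sdiff_subset
    obtain ⟨x, hx⟩ : (C \ Q).Nonempty := card_pos.1 (by omega)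
    refine Gn.mark (a := 1) (b := 0) (P := P) (Q := C \ Q) hd' hP Subset.rfl hPn
      (fun p hp q hq => (hfull p (hP hp) q (sdiff_subset hq)).symm) ?_ ?_ (by omega) (by omega)
    · exact good1 (GoodAt.of_full (K := L \ P) (hd'.mono_right sdiff_subset) hx Subset.rfl
        (fun l hl c hc => hfull l (sdiff_subset hl) c (sdiff_subset hc)) (by omega))
    · apply Gn.base
      rw [sdiff_self]
      refine ⟨disjoint_bot_left, fun Q hQ hn => ?_⟩
      obtain ⟨q, hq⟩ := hn
      have := hQ hq
      simp at this

lemma Y4 {C L : Finset V} (hH : HC G 1 C L) (hcard : L.card = C.card + 3)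
    (hd : ∀ l ∈ L, 3 ≤ dg G C l) (h4 : 4 ≤ C.card)
    (hR : ∀ R ⊆ C, R.card = 3 → ∀ N ⊆ L, (∀ l ∈ N, ∀ c ∈ C, G.Adj c l → c ∈ R) → N.card ≤ 3) :
    Gn G C L 3 := by
  by_cases hg : ∃ z, GoodAt G z C L
  · obtain ⟨z, hz⟩ := hg
    refine Gn.good_cherry hz (a := 2) (b := 2) ?_ ?_ (by omega) (by omega)
    · intro L' hL' hc hH'
      obtain ⟨R, hRC, N, hN, hHR, hcR, hcl, hback⟩ := peel hH'
      apply hback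
      have hdR : ∀ l ∈ N, 3 ≤ dg G R l := fun l hl =>
        (hd l (hL' (hN hl))).trans (dg_mono (hcl l hl))
      obtain ⟨l, hl⟩ : N.Nonempty := card_pos.1 (by omega)
      have h3 := (hdR l hl).trans (dg_le_card _ _)
      apply N1 hHR (by omega) hdR
      by_contra hcon
      have := hR R hRC (by omega) N (hN.trans hL') hcl
      omega
    · have e := card_erase_of_mem hz.2.1
      have hd2 : ∀ l ∈ L, 2 ≤ dg G (C.erase z) l := fun l hl => by
        have := dg_erase (G := G) C z l
        have := hd l hl
        omega
      exact U2 z ((hH.mono_left (erase_subset _ _)).weaken (by omega)) (by omega)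
        (fun l hl => le_trans (by omega) (hd2 l hl)) (fun l hl _ => hd2 l hl)
  · push Not at hg
    obtain ⟨B, hB, hBn, hBc, hHB, hHR, cl1, cl2⟩ := dich hH (card_pos.1 (by omega)) hg
    have e1 := card_sdiff_add_card_eq_card hB
    have hN : nb G B L ⊆ L := nb_subset _ _
    have e2 := card_sdiff_add_card_eq_card hN
    refine Gn.split (a := 1) (b := 2) hH.1 hB hN ((package G 3).2 _ _ (hHB.weaken (by omega))
      (by omega) ?_) (F23 (hHR.weaken (by omega)) (by omega) ?_) (by omega)
    · exact fun l hl => (hd l (hN hl)).trans (dg_mono (fun c hc ha => cl1 c hc l hl ha))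
    · exact fun l hl => (hd l (sdiff_subset hl)).trans (dg_mono (fun c hc ha => cl2 c hc l hl ha))

lemma K1aux {C L : Finset V} {s c : V} (hH : HC G 1 C L) (hcard : L.card = C.card + 1)
    (hd : ∀ l ∈ L, 5 ≤ dg G C l) (hs : s ∈ C) (hc : c ∈ C.erase s)
    (h : Gn G ((C.erase s).erase c) L 3) : Gn G C L 3 := by
  have e1 := card_erase_of_mem hs
  have e2 := card_pos.2 ⟨s, hs⟩
  obtain ⟨l, hl, ha⟩ := exists_leaf hH hs
  have el := card_erase_of_mem hl
  refine Gn.edge (a := 2) hH.1 hs hl ha ?_ ?_ (by omega)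
  · exact beta_swap (package G 5).1 (hH.erase_leaf l) (by omega) (card_pos.1 (by omega))
      (fun l hl => hd l (mem_of_mem_erase hl))
  · have hH1 : HC G 1 (C.erase s) L := hH.mono_left (erase_subset _ _)
    obtain ⟨l', hl', ha'⟩ := exists_leaf hH1 hc
    have el' := card_erase_of_mem hl'
    refine Gn.edge (a := 2) hH1.1 hc hl' ha' ?_ h (by omega)
    refine (package G 4).2 _ _ (hH1.erase_leaf l') (by omega) (fun l hl => ?_)
    have := hd l (mem_of_mem_erase hl)
    have := dg_erase (G := G) C s l
    omega

lemma K1 {C L : Finset V} (hH : HC G 0 C L) (hcard : L.card = C.card + 1)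
    (hd : ∀ l ∈ L, 5 ≤ dg G C l) : Gn G C L 3 := by
  classical
  obtain ⟨C', hC, L', hL, hH', hcard', hcl, hback⟩ := peel hH
  apply hback
  have hd' : ∀ l ∈ L', 5 ≤ dg G C' l := fun l hl =>
    (hd l (hL hl)).trans (dg_mono (hcl l hl))
  replace hcard' : L'.card = C'.card + 1 := by omega
  clear hback hcl hH hd hC hL hcard
  clear C L
  rename' C' => C, L' => L, hH' => hH, hd' => hd, hcard' => hcard
  obtain ⟨l, hl⟩ : L.Nonempty := card_pos.1 (by omega)
  have h5 := (hd l hl).trans (dg_le_card _ _)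
  have low : ∀ s c, ∀ l ∈ L, 3 ≤ dg G ((C.erase s).erase c) l := by
    intro s c l hl
    have := hd l hl
    have := dg_erase (G := G) C s l
    have := dg_erase (G := G) (C.erase s) c l
    omega
  have hHsub : ∀ s c, HC G 1 ((C.erase s).erase c) L := fun s c =>
    hH.mono_left ((erase_subset _ _).trans (erase_subset _ _))
  by_cases h6 : C.card = 5
  · obtain ⟨s, hs⟩ : C.Nonempty := card_pos.1 (by omega)
    have e1 := card_erase_of_mem hs
    obtain ⟨c, hc⟩ : (C.erase s).Nonempty := card_pos.1 (by omega)
    have e2 := card_erase_of_mem hc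
    exact K1aux hH hcard hd hs hc (Y3 (hHsub s c).1 (by omega) (by omega) (low s c))
  have hDc := card_filter_le L (fun l => dg G C l ≤ 5)
  set D5 := L.filter (fun l => dg G C l ≤ 5) with hD5
  obtain ⟨s, hs, hsD⟩ := avg (G := G) (C := C) (W := D5) 5 5
    (fun l hl => (mem_filter.1 hl).2) (by omega)
  set D := D5.filter (fun l => G.Adj l s) with hD
  have hDc : D.card ≤ 5 := by
    refine le_trans (le_of_eq ?_) hsD
    unfold dg
    congr
  have e1 := card_erase_of_mem hs
  -- the key consequence of a violated condition
  have key : ∀ c ∈ C.erase s, ∀ R ⊆ (C.erase s).erase c, R.card = 3 → ∀ N ⊆ L,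
      (∀ l ∈ N, ∀ x ∈ (C.erase s).erase c, G.Adj x l → x ∈ R) →
      N ⊆ D ∧ (∀ l ∈ N, G.Adj c l) ∧
        ∃ X ⊆ C, X.card ≤ 5 ∧ ∀ l ∈ N, ∀ x ∈ C, G.Adj x l → x ∈ X := by
    intro c hc R hR hRc N hN hcl
    have hle : ∀ l ∈ N, dg G ((C.erase s).erase c) l ≤ 3 := fun l hl =>
      (dg_mono (hcl l hl)).trans ((dg_le_card _ _).trans hRc.le)
    refine ⟨?_, ?_, insert s (insert c R), ?_, ?_, ?_⟩
    · intro l hl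
      have h0 := hle l hl
      have h1 := hd l (hN hl)
      have h2 := dg_erase (G := G) C s l
      have h3 := dg_erase (G := G) (C.erase s) c l
      rw [hD, mem_filter, hD5, mem_filter]
      refine ⟨⟨hN hl, by omega⟩, ?_⟩
      by_contra hn
      have := dg_erase_of_not_adj (G := G) C (fun h => hn (SimpleGraph.Adj.symm h) : ¬ G.Adj s l)
      omega
    · intro l hl
      have h0 := hle l hl
      have h1 := hd l (hN hl)
      have h2 := dg_erase (G := G) C s l
      by_contra hn
      have := dg_erase_of_not_adj (G := G) (C.erase s) hn
      omega
    · intro x hx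
      rw [mem_insert, mem_insert] at hx
      rcases hx with rfl | rfl | hx
      · exact hs
      · exact mem_of_mem_erase hc
      · exact mem_of_mem_erase (mem_of_mem_erase (hR hx))
    · have := card_insert_le s (insert c R)
      have := card_insert_le c R
      omega
    · intro l hl x hx ha
      rw [mem_insert, mem_insert]
      by_cases hxs : x = s
      · exact Or.inl hxs
      by_cases hxc : x = c
      · exact Or.inr (Or.inl hxc)
      · exact Or.inr (Or.inr (hcl l hl x (mem_erase.2 ⟨hxc, mem_erase.2 ⟨hxs, hx⟩⟩) ha))
  by_cases hex : ∃ N ⊆ D, 4 ≤ N.card ∧ ∃ X ⊆ C, X.card ≤ 5 ∧ ∀ l ∈ N, ∀ x ∈ C, G.Adj x l → x ∈ X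
  · obtain ⟨N0, hN0, hN0c, X, hX, hXc, hXN⟩ := hex
    obtain ⟨c, hcC, hcX⟩ := exists_mem_notMem_of_card_lt_card (show X.card < C.card by omega)
    have hsX : s ∈ X := by
      obtain ⟨l, hl⟩ : N0.Nonempty := card_pos.1 (by omega)
      have := hN0 hl
      rw [hD, mem_filter] at this
      exact hXN l hl s hs this.2.symm
    have hc : c ∈ C.erase s := mem_erase.2 ⟨fun h => hcX (h ▸ hsX), hcC⟩
    have e2 := card_erase_of_mem hc
    refine K1aux hH hcard hd hs hc (Y4 (hHsub s c) (by omega) (low s c) (by omega) ?_)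
    intro R hR hRc N hN hcl
    obtain ⟨k1, k2, _⟩ := key c hc R hR hRc N hN hcl
    by_contra hcon
    have u1 := card_le_card (union_subset k1 hN0)
    have u2 := card_union_add_card_inter N N0
    obtain ⟨l, hl⟩ : (N ∩ N0).Nonempty := card_pos.1 (by omega)
    rw [mem_inter] at hl
    exact hcX (hXN l hl.2 c hcC (k2 l hl.1))
  · obtain ⟨c, hc⟩ : (C.erase s).Nonempty := card_pos.1 (by omega)
    have e2 := card_erase_of_mem hc
    refine K1aux hH hcard hd hs hc (Y4 (hHsub s c) (by omega) (low s c) (by omega) ?_)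
    intro R hR hRc N hN hcl
    obtain ⟨k1, k2, k3⟩ := key c hc R hR hRc N hN hcl
    by_contra hcon
    exact hex ⟨N, k1, by omega, k3⟩

end
end SlowCol

namespace SlowCol
open Finset

section
set_option linter.unusedSectionVars false
set_option linter.unusedVariables false
variable {V : Type*} [DecidableEq V] {G : SimpleGraph V}

lemma sc_take {J : Finset V} {a b : V} (ha : a ∈ J) (hb : b ∈ J) (h : G.Adj a b) :
    3 + sc G (J \ {a, b}) ≤ sc G J := by
  have h1 := sc_superadd G (X := {a, b}) (Y := J \ {a, b}) (A := J) disjoint_sdiff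
    (by rw [union_sdiff_of_subset (pair_subset ha hb)])
  have := sc_pair h
  omega

lemma sc_two {J : Finset V} {a b c d : V} (ha : a ∈ J) (hb : b ∈ J) (hc : c ∈ J) (hd : d ∈ J)
    (h : G.Adj a b) (h' : G.Adj c d) (hac : c ≠ a) (hbc : c ≠ b) (had : d ≠ a) (hbd : d ≠ b) :
    J.card + 2 ≤ sc G J := by
  have h1 := sc_take ha hb h
  have h2 := sc_take (J := J \ {a, b}) (a := c) (b := d) (by simp [hc, hac, hbc])
    (by simp [hd, had, hbd]) h'
  have h3 := sc_ge_card G ((J \ {a, b}) \ {c, d})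
  have h4 := card_sdiff_add_card_eq_card (pair_subset ha hb)
  have h5 := card_sdiff_add_card_eq_card (pair_subset (A := J \ {a, b}) (u := c) (v := d)
    (by simp [hc, hac, hbc]) (by simp [hd, had, hbd]))
  rw [card_pair h.ne] at h4
  rw [card_pair h'.ne] at h5
  omega

variable [Fintype V]

lemma min_deg {m : ℕ} (h : G.MConnected m) (v : V) : m ≤ dg G univ v := by
  classical
  by_contra hcon
  set N := univ.filter (fun c => G.Adj c v) with hN
  have hNc : N.card < m := by
    have : N.card = dg G univ v := by
      unfold dg
      congr
    omega
  have hcn := h.2 N hNc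
  have hc : (insert v N).card < (univ : Finset V).card := by
    have h1 := card_insert_le v N
    have h2 := h.1
    rw [card_univ]
    omega
  obtain ⟨w, _, hw⟩ := exists_mem_notMem_of_card_lt_card hc
  rw [mem_insert, not_or] at hw
  have hv : v ∈ ((univ \ N : Finset V) : Set V) := by simp [hN]
  have hw' : w ∈ ((univ \ N : Finset V) : Set V) := by simpa using hw.2
  obtain ⟨p⟩ := hcn.preconnected ⟨v, hv⟩ ⟨w, hw'⟩
  cases p with
  | nil => exact hw.1 rfl
  | @cons _ u _ hadj _ =>
    have hu := u.2
    have ha : G.Adj v u.1 := hadj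
    simp only [coe_sdiff, coe_univ, Set.mem_sdiff, Set.mem_univ, true_and, mem_coe] at hu
    exact hu (by simp [hN, ha.symm])

lemma pm_of {M : G.Subgraph} (hM : M.IsPerfectMatching) :
    ∃ p : V → V, ∀ v, G.Adj v (p v) ∧ p (p v) = v := by
  rw [SimpleGraph.Subgraph.isPerfectMatching_iff] at hM
  choose p hp hu using hM
  refine ⟨p, fun v => ⟨(hp v).adj_sub, ?_⟩⟩
  exact (hu (p v) v (hp v).symm).symm

lemma T_card {p : V → V} (hp : ∀ v, G.Adj v (p v) ∧ p (p v) = v) {T : Finset V}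
    (hT : ∀ u ∈ T, ∀ v ∈ T, ¬ G.Adj u v) : HC G 0 T (univ \ T) := by
  apply hall_conv disjoint_sdiff p
  · intro c hc
    refine ⟨?_, (hp c).1⟩
    simp only [mem_sdiff, mem_univ, true_and]
    exact fun h => hT c hc _ h (hp c).1
  · intro x _ y _ hxy
    have := congrArg p hxy
    rwa [(hp x).2, (hp y).2] at this

lemma Kdel {p : V → V} (hp : ∀ v, G.Adj v (p v) ∧ p (p v) = v) {m : ℕ}
    (hm : Fintype.card V = 2 * m) (hdeg : ∀ v, 6 ≤ dg G univ v) {T : Finset V}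
    (hT : ∀ u ∈ T, ∀ v ∈ T, ¬ G.Adj u v) (hTc : T.card = m) {s : V} (hs : s ∉ T) :
    3 * m + 1 ≤ sc G (univ.erase s) := by
  have h1 := T_card hp hT
  have e := card_sdiff_add_card_eq_card (subset_univ T)
  rw [card_univ] at e
  have hsS : s ∈ univ \ T := by simp [hs]
  have e2 := card_erase_of_mem hsS
  have e3 := card_pos.2 ⟨s, hsS⟩
  have h2 : HC G 0 ((univ \ T).erase s) T := (h1.swap (by omega)).mono_left (erase_subset _ _)
  have h3 : Gn G ((univ \ T).erase s) T 3 := by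
    apply K1 h2 (by omega)
    intro l hl
    have a1 := hdeg l
    have a2 : dg G univ l ≤ dg G (univ \ T) l := dg_mono (fun c _ ha => by
      simp only [mem_sdiff, mem_univ, true_and]
      exact fun hc => hT c hc l hl ha)
    have a3 := dg_erase (G := G) (univ \ T) s l
    omega
  unfold Gn at h3
  have h4 : sc G ((univ \ T).erase s ∪ T) ≤ sc G (univ.erase s) := by
    apply sc_mono
    intro x hx
    rw [mem_erase]
    refine ⟨?_, mem_univ _⟩
    rintro rfl
    simp [hs] at hx
  omega

lemma T_bound {p : V → V} (hp : ∀ v, G.Adj v (p v) ∧ p (p v) = v) {m : ℕ}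
    (hm : Fintype.card V = 2 * m) (hm0 : 0 < m) (hdeg : ∀ v, 6 ≤ dg G univ v) {T : Finset V}
    (hT : ∀ u ∈ T, ∀ v ∈ T, ¬ G.Adj u v) (hTc : T.card = m) : 3 * m + 3 ≤ sc G univ := by
  by_cases hS : ∃ u, ∃ v, u ∉ T ∧ v ∉ T ∧ G.Adj u v
  · obtain ⟨u, v, hu, hv, ha⟩ := hS
    have h1 := Kdel hp hm hdeg hT hTc hu
    have h2 := Kdel hp hm hdeg hT hTc hv
    exact sc_edge G (mem_univ u) (mem_univ v) ha (by omega) (by omega)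
  · push Not at hS
    obtain ⟨t, ht⟩ : T.Nonempty := card_pos.1 (by omega)
    have e := card_sdiff_add_card_eq_card (subset_univ T)
    rw [card_univ] at e
    have h1 := Kdel hp hm hdeg hT hTc (s := p t) (fun h => hT t ht _ h (hp t).1)
    have h2 := Kdel hp hm hdeg (T := univ \ T) (fun u hu v hv => hS u v (by simpa using hu)
      (by simpa using hv)) (by omega) (s := t) (by simpa using ht)
    exact sc_edge G (mem_univ t) (mem_univ (p t)) (hp t).1 (by omega) (by omega)

lemma two_case {p : V → V} (hp : ∀ v, G.Adj v (p v) ∧ p (p v) = v) {m : ℕ}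
    (hm : Fintype.card V = 2 * m) (hm0 : 0 < m) (hdeg : ∀ v, 6 ≤ dg G univ v) :
    3 * m + 3 ≤ sc G univ := by
  classical
  by_cases htri : ∃ a b c, G.Adj a b ∧ G.Adj b c ∧ G.Adj a c
  · obtain ⟨a, b, c, hab, hbc, hac⟩ := htri
    refine sc_triangle G (mem_univ a) (mem_univ b) (mem_univ c) hab hbc hac (fun x _ => ?_)
    have hPM : PM G (univ : Finset V) := ⟨p, fun v _ => ⟨mem_univ _, hp v⟩⟩
    obtain ⟨r, _, hr, hP⟩ := hPM.partner (mem_univ x)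
    have he : univ \ {x, r} = (univ.erase x).erase r := by
      ext y
      simp only [mem_sdiff, mem_univ, true_and, mem_insert, mem_singleton, mem_erase]
      tauto
    rw [he] at hP
    have h1 := (a_all G 5).2 (univ.erase x) r (mem_erase.2 ⟨hr.ne.symm, mem_univ _⟩) hP
      (fun v _ => by
        have := hdeg v
        have := dg_erase (G := G) univ x v
        omega)
    rw [card_erase_of_mem (mem_univ x), card_univ] at h1
    omega
  by_cases hTex : ∃ T : Finset V, (∀ u ∈ T, ∀ v ∈ T, ¬ G.Adj u v) ∧ T.card = m
  · obtain ⟨T, hT, hTc⟩ := hTex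
    exact T_bound hp hm hm0 hdeg hT hTc
  have hne : (univ : Finset V).Nonempty := card_pos.1 (by rw [card_univ]; omega)
  refine sc_step G Subset.rfl hne (fun I hI => ?_)
  have hIi := hI.2.1
  rw [card_univ]
  have e := card_sdiff_add_card_eq_card (subset_univ I)
  rw [card_univ] at e
  have hIm := (T_card hp hIi).card0
  have hIne : I.card ≠ m := fun h => hTex ⟨I, hIi, h⟩
  set J := univ \ I with hJ
  have memJ : ∀ x, x ∈ J ↔ x ∉ I := by simp [hJ]
  set J' := J.filter (fun v => p v ∈ J) with hJ'
  have hJ'J : J' ⊆ J := filter_subset _ _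
  have hPM : PM G J' := by
    refine ⟨p, fun v hv => ⟨?_, hp v⟩⟩
    rw [hJ', mem_filter] at hv ⊢
    exact ⟨hv.2, by rw [(hp v).2]; exact hv.1⟩
  have hcard : (J \ J').card = I.card := by
    have : J \ J' = I.image p := by
      ext x
      simp only [mem_sdiff, hJ', mem_filter, memJ, mem_image]
      constructor
      · rintro ⟨h1, h2⟩
        refine ⟨p x, ?_, (hp x).2⟩
        by_contra h
        exact h2 ⟨h1, h⟩
      · rintro ⟨y, hy, rfl⟩
        rw [(hp y).2]
        exact ⟨fun h => hIi y hy _ h (hp y).1, fun h => h.2 hy⟩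
    rw [this, card_image_of_injective]
    intro x y hxy
    have := congrArg p hxy
    rwa [(hp x).2, (hp y).2] at this
  have e2 := card_sdiff_add_card_eq_card hJ'J
  by_cases ht : I.card + 2 ≤ m
  · have h1 := pm_base _ J' rfl hPM
    have h2 := sc_superadd G (X := J') (Y := J \ J') (A := J) disjoint_sdiff
      (by rw [union_sdiff_of_subset hJ'J])
    have h3 := sc_ge_card G (J \ J')
    omega
  have hJ'2 : J'.card = 2 := by omega
  suffices J.card + 2 ≤ sc G J by omega
  obtain ⟨a, ha⟩ : J'.Nonempty := card_pos.1 (by omega)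
  have hb := ha
  rw [hJ', mem_filter] at hb
  obtain ⟨haJ, hbJ⟩ := hb
  have hab := (hp a).1
  generalize p a = b at hbJ hab
  have find : ∀ x ∈ J, ∃ u ∈ J, ∃ v ∈ J, u ≠ x ∧ v ≠ x ∧ G.Adj u v := by
    intro x hx
    by_contra hcon
    push Not at hcon
    have := card_erase_of_mem hx
    refine hTex ⟨J.erase x, fun u hu v hv => ?_, by omega⟩
    rw [mem_erase] at hu hv
    exact hcon u hu.2 v hv.2 hu.1 hv.1
  -- either a disjoint edge or an edge at the other end
  have find2 : ∀ x ∈ J, ∀ y ∈ J, G.Adj x y → J.card + 2 ≤ sc G J ∨ ∃ w ∈ J, w ≠ x ∧ G.Adj y w := by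
    intro x hx y hy hxy
    obtain ⟨u, hu, v, hv, hux, hvx, huv⟩ := find x hx
    by_cases h1 : u = y
    · subst h1
      exact Or.inr ⟨v, hv, hvx, huv⟩
    by_cases h2 : v = y
    · subst h2
      exact Or.inr ⟨u, hu, hux, huv.symm⟩
    exact Or.inl (sc_two hx hy hu hv hxy huv hux h1 hvx h2)
  rcases find2 a haJ b hbJ hab with h | ⟨w, hw, hwa, hbw⟩
  · exact h
  rcases find2 b hbJ a haJ hab.symm with h | ⟨w', hw', hwb, haw⟩
  · exact h
  have hne' : w ≠ w' := by
    rintro rfl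
    exact htri ⟨a, b, w, hab, hbw, haw⟩
  exact sc_two hbJ hw haJ hw' hbw haw hab.ne hwa.symm hwb hne'.symm

theorem main (k : ℕ) (hk : 2 ≤ k) (hconn : G.MConnected (3 * k))
    (hpm : ∃ M : G.Subgraph, M.IsPerfectMatching) :
    3 * Fintype.card V + 2 * k < 2 * G.sumColorCost := by
  have hs : G.sumColorCost = sc G univ := sc_eq G (by rw [card_univ])
  rw [hs]
  obtain ⟨M, hM⟩ := hpm
  obtain ⟨p, hp⟩ := pm_of hM
  have hev := hM.even_card
  have hpos := hconn.1
  by_cases hk2 : k = 2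
  · subst hk2
    obtain ⟨m, hm⟩ := hev
    have := two_case (G := G) hp (m := m) (by omega) (by omega) (fun v => min_deg hconn v)
    omega
  · have := (a_all G (3 * k)).1 univ (card_pos.1 (by rw [card_univ]; omega))
      ⟨p, fun v _ => ⟨mem_univ _, hp v⟩⟩ (fun v _ => min_deg hconn v)
    rw [card_univ] at this
    omega

end
end SlowCol

/-- For `k ≥ 2` the bound of the main theorem is not attained:
`2·𝓈(G) > 3n + 2k` for `3k`-connected graphs on `n ≥ 4k` vertices with a
perfect matching. -/
theorem slow_coloring_strict_of_two_le {V : Type*} [Fintype V] [DecidableEq V]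
    (G : SimpleGraph V) (k : ℕ) (hk : 2 ≤ k)
    (hconn : G.MConnected (3 * k)) (hn : 4 * k ≤ Fintype.card V)
    (hpm : ∃ M : G.Subgraph, M.IsPerfectMatching) :
    3 * Fintype.card V + 2 * k < 2 * G.sumColorCost := by
  exact SlowCol.main k hk hconn hpm
end

section
/- For every tree T on n ≥ 1 vertices, 𝓈(T) ≤ ⌊3n/2⌋, and the path P_n on n vertices satisfies 𝓈(P_n) = ⌊3n/2⌋. -/
/-! Definitions for the slow coloring game (sum-color cost), paintability,
connectivity and auxiliary graphs. -/

variable {V : Type*}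

/-! ## Ordered forests (left-child, right-sibling) -/

/-- Ordered forests with vertices labelled by `V`. -/
inductive LForest (V : Type*) where
  | nil : LForest V
  | node (v : V) (c s : LForest V) : LForest V

namespace LForest

variable {V : Type*} [DecidableEq V]

/-- list of vertices -/
def verts : LForest V → List V
  | nil => []
  | node v c s => v :: (verts c ++ verts s)

/-- number of vertices in `X` -/
def cnt (X : Finset V) : LForest V → ℕ
  | nil => 0
  | node v c s => (if v ∈ X then 1 else 0) + cnt X c + cnt X s

/-- number of vertices of the `X`-components containing a root -/
def att (X : Finset V) : LForest V → ℕ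
  | nil => 0
  | node v c s => (if v ∈ X then 1 + att X c else 0) + att X s

/-- number of odd components, not counting those containing roots, if `b`;
all odd components otherwise. -/
def oc (X : Finset V) : Bool → LForest V → ℕ
  | _, nil => 0
  | b, node v c s =>
    (if v ∈ X then (if b then 0 else (1 + att X c) % 2) + oc X true c else oc X false c) + oc X b s

/-- no root in `D` -/
def avoid (D : Finset V) : LForest V → Prop
  | nil => True
  | node v _ s => v ∉ D ∧ avoid D s

/-- `D` is independent -/
def ind (D : Finset V) : LForest V → Prop
  | nil => True
  | node v c s => (v ∈ D → avoid D c) ∧ ind D c ∧ ind D s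

theorem cnt_congr {X Y : Finset V} (f : LForest V) (h : ∀ v ∈ verts f, v ∈ X ↔ v ∈ Y) :
    cnt X f = cnt Y f := by
  induction f with
  | nil => rfl
  | node v c s ihc ihs =>
    simp only [verts, List.mem_cons, List.mem_append] at h
    simp only [cnt, h v (Or.inl rfl), ihc (fun w hw => h w (by tauto)),
      ihs (fun w hw => h w (by tauto))]

theorem att_congr {X Y : Finset V} (f : LForest V) (h : ∀ v ∈ verts f, v ∈ X ↔ v ∈ Y) :
    att X f = att Y f := by
  induction f with
  | nil => rfl
  | node v c s ihc ihs =>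
    simp only [verts, List.mem_cons, List.mem_append] at h
    simp only [att, h v (Or.inl rfl), ihc (fun w hw => h w (by tauto)),
      ihs (fun w hw => h w (by tauto))]

theorem oc_congr {X Y : Finset V} (f : LForest V) (h : ∀ v ∈ verts f, v ∈ X ↔ v ∈ Y) (b : Bool) :
    oc X b f = oc Y b f := by
  induction f generalizing b with
  | nil => rfl
  | node v c s ihc ihs =>
    simp only [verts, List.mem_cons, List.mem_append] at h
    simp only [oc, h v (Or.inl rfl), ihc (fun w hw => h w (by tauto)),
      ihs (fun w hw => h w (by tauto)), att_congr c (fun w hw => h w (by tauto))]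

theorem avoid_congr {X Y : Finset V} (f : LForest V) (h : ∀ v ∈ verts f, v ∈ X ↔ v ∈ Y) :
    avoid X f ↔ avoid Y f := by
  induction f with
  | nil => rfl
  | node v c s ihc ihs =>
    simp only [verts, List.mem_cons, List.mem_append] at h
    simp only [avoid, h v (Or.inl rfl), ihs (fun w hw => h w (by tauto))]

theorem ind_congr {X Y : Finset V} (f : LForest V) (h : ∀ v ∈ verts f, v ∈ X ↔ v ∈ Y) :
    ind X f ↔ ind Y f := by
  induction f with
  | nil => rfl
  | node v c s ihc ihs =>
    simp only [verts, List.mem_cons, List.mem_append] at h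
    simp only [ind, h v (Or.inl rfl), ihc (fun w hw => h w (by tauto)),
      ihs (fun w hw => h w (by tauto)), avoid_congr c (fun w hw => h w (by tauto))]

theorem oc_parity (X : Finset V) (f : LForest V) :
    oc X false f % 2 = cnt X f % 2 ∧ (oc X true f + att X f) % 2 = cnt X f % 2 := by
  induction f with
  | nil => simp [oc, cnt, att]
  | node v c s ihc ihs =>
    simp only [oc, cnt, att]
    split_ifs <;> simp_all <;> omega

theorem oc_le (X : Finset V) (f : LForest V) (b : Bool) : oc X b f ≤ cnt X f := by
  induction f generalizing b with
  | nil => simp [oc]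
  | node v c s ihc ihs =>
    simp only [oc, cnt]
    have := ihc true
    have := ihc false
    have := ihs b
    split_ifs <;> omega

theorem cnt_sdiff {A D : Finset V} (h : D ⊆ A) (f : LForest V) :
    cnt (A \ D) f + cnt D f = cnt A f := by
  induction f with
  | nil => rfl
  | node v c s ihc ihs =>
    simp only [cnt, Finset.mem_sdiff]
    have := @h v
    by_cases h1 : v ∈ A <;> by_cases h2 : v ∈ D <;> simp_all <;> omega

theorem cnt_eq_card (f : LForest V) (hf : f.verts.Nodup) (X : Finset V) :
    cnt X f = (X ∩ f.verts.toFinset).card := by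
  induction f with
  | nil => simp [cnt, verts]
  | node v c s ihc ihs =>
    simp only [verts, List.nodup_cons, List.nodup_append, List.mem_append] at hf
    obtain ⟨hv, hc, hs, hd⟩ := hf
    have e : X ∩ (verts (node v c s)).toFinset =
        (X ∩ {v}) ∪ ((X ∩ c.verts.toFinset) ∪ (X ∩ s.verts.toFinset)) := by
      ext w; simp [verts]; tauto
    have d1 : Disjoint (X ∩ c.verts.toFinset) (X ∩ s.verts.toFinset) := by
      rw [Finset.disjoint_left]
      intro w h1 h2
      simp at h1 h2
      exact hd _ h1.2 _ h2.2 rfl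
    have d2 : Disjoint (X ∩ {v}) ((X ∩ c.verts.toFinset) ∪ (X ∩ s.verts.toFinset)) := by
      rw [Finset.disjoint_left]
      intro w h1 h2
      simp at h1 h2
      obtain ⟨_, rfl⟩ := h1
      tauto
    rw [e, Finset.card_union_of_disjoint d2, Finset.card_union_of_disjoint d1, cnt, ihc hc, ihs hs]
    by_cases h : v ∈ X <;> simp [h] <;> omega

/-! ## The Painter invariant -/

/-- Candidate moves. -/
def Ok (M : Finset V) (f : LForest V) (D : Finset V) : Prop :=
  D ⊆ M ∧ (∀ v ∈ D, v ∈ verts f) ∧ ind D f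

/-- The inductive invariant. -/
def Inv (A M : Finset V) (f : LForest V) : Prop :=
  ∃ K : ℕ,
    (∃ D, Ok M f D ∧ 2 * cnt M f + oc A true f + K ≤ 3 * cnt D f + oc (A \ D) true f ∧
      (att (A \ D) f + att A f + K) % 2 = 0) ∧
    (∃ D, Ok M f D ∧ avoid D f ∧
      2 * cnt M f + oc A true f ≤ 3 * cnt D f + oc (A \ D) false f + K) ∧
    (∃ D, Ok M f D ∧ 2 * cnt M f + oc A false f ≤ 3 * cnt D f + oc (A \ D) false f)

theorem inv_nil (A M : Finset V) : Inv A M nil := by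
  have h0 : Ok M (nil : LForest V) ∅ := by simp [Ok, ind]
  exact ⟨0, ⟨∅, h0, by simp [cnt, oc], by simp [att]⟩,
    ⟨∅, h0, trivial, by simp [cnt, oc]⟩, ⟨∅, h0, by simp [cnt, oc]⟩⟩

/-- Gluing candidates. -/
theorem glue (A M : Finset V) (v : V) (c s : LForest V) (hn : (verts (node v c s)).Nodup)
    {D E : Finset V} (hD : Ok M (node v c nil) D) (hE : Ok M s E) :
    Ok M (node v c s) (D ∪ E) ∧
    cnt (D ∪ E) (node v c s) = cnt D (node v c nil) + cnt E s ∧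
    (∀ b, oc (A \ (D ∪ E)) b (node v c s) = oc (A \ D) b (node v c nil) + oc (A \ E) b s) ∧
    att (A \ (D ∪ E)) (node v c s) = att (A \ D) (node v c nil) + att (A \ E) s ∧
    (avoid D (node v c nil) → avoid E s → avoid (D ∪ E) (node v c s)) := by
  obtain ⟨hD1, hD2, hD3⟩ := hD
  obtain ⟨hE1, hE2, hE3⟩ := hE
  simp only [verts, List.nodup_cons, List.nodup_append, List.mem_append] at hn
  obtain ⟨hv, hc, hs, hd⟩ := hn
  simp only [verts, List.append_nil, List.mem_cons] at hD2
  have k1 : v ∈ D ∪ E ↔ v ∈ D := by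
    have := hE2 v; simp only [Finset.mem_union]; tauto
  have k2 : ∀ w ∈ verts c, w ∈ D ∪ E ↔ w ∈ D := by
    intro w hw
    have h1 : w ∉ E := fun h => hd w hw w (hE2 w h) rfl
    simp [h1]
  have k3 : ∀ w ∈ verts s, w ∈ D ∪ E ↔ w ∈ E := by
    intro w hw
    have h1 : w ∉ D := by
      intro h
      rcases hD2 w h with rfl | h'
      · exact hv (Or.inr hw)
      · exact hd w h' w hw rfl
    simp [h1]
  have l2 : ∀ w ∈ verts c, w ∈ A \ (D ∪ E) ↔ w ∈ A \ D := by
    intro w hw; rw [Finset.mem_sdiff, Finset.mem_sdiff, k2 w hw]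
  have l3 : ∀ w ∈ verts s, w ∈ A \ (D ∪ E) ↔ w ∈ A \ E := by
    intro w hw; rw [Finset.mem_sdiff, Finset.mem_sdiff, k3 w hw]
  have l1 : v ∈ A \ (D ∪ E) ↔ v ∈ A \ D := by
    rw [Finset.mem_sdiff, Finset.mem_sdiff, k1]
  refine ⟨⟨Finset.union_subset hD1 hE1, ?_, ?_⟩, ?_, ?_, ?_, ?_⟩
  · intro w hw
    simp only [verts, List.mem_cons, List.mem_append]
    rcases Finset.mem_union.1 hw with h | h
    · have := hD2 w h; tauto
    · have := hE2 w h; tauto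
  · simp only [ind] at hD3 ⊢
    rw [k1, avoid_congr c k2, ind_congr c k2, ind_congr s k3]
    tauto
  · simp only [cnt, k1, cnt_congr c k2, cnt_congr s k3]; omega
  · intro b
    simp only [oc, l1, att_congr c l2, oc_congr c l2, oc_congr s l3]; omega
  · simp only [att, l1, att_congr c l2, att_congr s l3]; omega
  · simp only [avoid, k1, avoid_congr s k3]; tauto

theorem split_stats (X : Finset V) (v : V) (c s : LForest V) :
    cnt X (node v c s) = cnt X (node v c nil) + cnt X s ∧
    (∀ b, oc X b (node v c s) = oc X b (node v c nil) + oc X b s) ∧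
    att X (node v c s) = att X (node v c nil) + att X s := by
  refine ⟨?_, fun b => ?_, ?_⟩ <;> simp [cnt, oc, att]

theorem inv_glue (A M : Finset V) (v : V) (c s : LForest V) (hn : (verts (node v c s)).Nodup)
    (h1 : Inv A M (node v c nil)) (h2 : Inv A M s) : Inv A M (node v c s) := by
  obtain ⟨K, ⟨D1, a1, b1, c1⟩, ⟨D2, a2, b2, c2⟩, ⟨D3, a3, b3⟩⟩ := h1
  obtain ⟨L, ⟨E1, p1, q1, r1⟩, ⟨E2, p2, q2, r2⟩, ⟨E3, p3, q3⟩⟩ := h2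
  obtain ⟨m1, m2, m3⟩ := split_stats M v c s
  obtain ⟨n1, n2, n3⟩ := split_stats A v c s
  obtain ⟨g1, g2, g3, g4, g5⟩ := glue A M v c s hn a1 p1
  obtain ⟨i1, i2, i3, i4, i5⟩ := glue A M v c s hn a2 p2
  obtain ⟨j1, j2, j3, j4, j5⟩ := glue A M v c s hn a3 p3
  refine ⟨K + L, ⟨_, g1, ?_, ?_⟩, ⟨_, i1, i5 b2 q2, ?_⟩, ⟨_, j1, ?_⟩⟩
  · rw [m1, n2, g2, g3]; omega
  · rw [n3, g4]; omega
  · rw [m1, n2, i2, i3]; omega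
  · rw [m1, n2, j2, j3]; omega

theorem inv_tree (A M : Finset V) (hMA : M ⊆ A) (v : V) (c : LForest V) (hv : v ∉ verts c)
    (h : Inv A M c) : Inv A M (node v c nil) := by
  obtain ⟨K, ⟨D1, ⟨a1, a1', a1''⟩, b1, c1⟩, ⟨D2, ⟨a2, a2', a2''⟩, b2, c2⟩,
    ⟨D3, ⟨a3, a3', a3''⟩, b3⟩⟩ := h
  have v1 : v ∉ D1 := fun h => hv (a1' v h)
  have v2 : v ∉ D2 := fun h => hv (a2' v h)
  have v3 : v ∉ D3 := fun h => hv (a3' v h)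
  have ok : ∀ D, v ∉ D → D ⊆ M → (∀ w ∈ D, w ∈ verts c) → ind D c → Ok M (node v c nil) D := by
    intro D h1 h2 h3 h4
    refine ⟨h2, fun w hw => ?_, ?_⟩
    · simp [verts, h3 w hw]
    · simp [ind, h1, h4]
  by_cases hA : v ∈ A
  swap
  · have hM : v ∉ M := fun h => hA (hMA h)
    refine ⟨0, ⟨D3, ok D3 v3 a3 a3' a3'', ?_, ?_⟩, ⟨D3, ok D3 v3 a3 a3' a3'', ?_, ?_⟩,
      ⟨D3, ok D3 v3 a3 a3' a3'', ?_⟩⟩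
    · simp [cnt, oc, hA, hM, v3, b3]
    · simp [att, hA]
    · simp [avoid, v3]
    · simp [cnt, oc, hA, hM, v3, b3]
    · simp [cnt, oc, hA, hM, v3, b3]
  by_cases hM : v ∈ M
  swap
  · refine ⟨K, ⟨D1, ok D1 v1 a1 a1' a1'', ?_, ?_⟩, ⟨D1, ok D1 v1 a1 a1' a1'', ?_, ?_⟩,
      ⟨D1, ok D1 v1 a1 a1' a1'', ?_⟩⟩
    · simp [cnt, oc, hA, hM, v1]; omega
    · simp [att, hA, v1]; omega
    · simp [avoid, v1]
    · simp [cnt, oc, hA, hM, v1]; omega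
    · simp [cnt, oc, hA, hM, v1]; omega
  have P1 := oc_parity A c
  have P2 := oc_parity (A \ D1) c
  have P3 := oc_parity (A \ D2) c
  have C1 := cnt_sdiff (a1.trans hMA) c
  have C2 := cnt_sdiff (a2.trans hMA) c
  by_cases hK : 2 ≤ K
  · refine ⟨K - 2, ⟨D1, ok D1 v1 a1 a1' a1'', ?_, ?_⟩, ⟨D1, ok D1 v1 a1 a1' a1'', ?_, ?_⟩,
      ⟨D1, ok D1 v1 a1 a1' a1'', ?_⟩⟩
    · simp [cnt, oc, hA, hM, v1]; omega
    · simp [att, hA, v1]; omega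
    · simp [avoid, v1]
    · simp [cnt, oc, hA, hM, v1]; omega
    · simp [cnt, oc, hA, hM, v1]; omega
  -- take `v`
  have t2 : ∀ w ∈ verts c, w ∈ insert v D2 ↔ w ∈ D2 := by
    intro w hw
    have : w ≠ v := fun h => hv (h ▸ hw)
    simp [this]
  have t3 : ∀ w ∈ verts c, w ∈ A \ insert v D2 ↔ w ∈ A \ D2 := by
    intro w hw; rw [Finset.mem_sdiff, Finset.mem_sdiff, t2 w hw]
  have okT : Ok M (node v c nil) (insert v D2) := by
    refine ⟨Finset.insert_subset hM a2, ?_, ?_⟩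
    · intro w hw
      rcases Finset.mem_insert.1 hw with rfl | h
      · simp [verts]
      · simp [verts, a2' w h]
    · simp only [ind]
      rw [avoid_congr c t2, ind_congr c t2]
      exact ⟨fun _ => b2, a2'', trivial⟩
  have e1 : cnt (insert v D2) (node v c nil) = 1 + cnt D2 c := by
    simp [cnt, cnt_congr c t2]
  have e2 : ∀ b, oc (A \ insert v D2) b (node v c nil) = oc (A \ D2) false c := by
    intro b; simp [oc, oc_congr c t3]
  have e3 : att (A \ insert v D2) (node v c nil) = 0 := by
    simp [att]
  refine ⟨if att A c % 2 = 0 then 1 else (if K = 0 then 2 else 0), ⟨_, okT, ?_, ?_⟩,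
    ⟨D1, ok D1 v1 a1 a1' a1'', ?_, ?_⟩, ⟨_, okT, ?_⟩⟩
  · rw [e1, e2]; simp [cnt, oc, hA, hM]; split_ifs <;> omega
  · rw [e3]; simp [att, hA]; split_ifs <;> omega
  · simp [avoid, v1]
  · simp [cnt, oc, hA, hM, v1]; split_ifs <;> omega
  · rw [e1, e2]; simp [cnt, oc, hA, hM]; omega

theorem inv_all (A M : Finset V) (hMA : M ⊆ A) (f : LForest V) (hf : f.verts.Nodup) :
    Inv A M f := by
  induction f with
  | nil => exact inv_nil A M
  | node v c s ihc ihs =>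
    have hn := hf
    simp only [verts, List.nodup_cons, List.nodup_append, List.mem_append] at hn
    exact inv_glue A M v c s hf (inv_tree A M hMA v c (by tauto) (ihc hn.2.1)) (ihs hn.2.2.1)

/-! ## Inserting a leaf -/

/-- insert `x` as a child of `u` -/
def ins (u x : V) : LForest V → LForest V
  | nil => nil
  | node v c s => if v = u then node v (node x nil c) s else node v (ins u x c) (ins u x s)

theorem ins_of_notMem (u x : V) (f : LForest V) (h : u ∉ verts f) : ins u x f = f := by
  induction f with
  | nil => rfl
  | node v c s ihc ihs =>
    simp only [verts, List.mem_cons, List.mem_append, not_or] at h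
    rw [ins, if_neg (Ne.symm h.1), ihc h.2.1, ihs h.2.2]

theorem verts_ins (u x : V) (f : LForest V) (hf : f.verts.Nodup) (h : u ∈ verts f) :
    (verts (ins u x f)).Perm (x :: verts f) := by
  induction f with
  | nil => simp [verts] at h
  | node v c s ihc ihs =>
    simp only [verts, List.nodup_cons, List.nodup_append, List.mem_append] at hf
    obtain ⟨hv, hc, hs, hd⟩ := hf
    simp only [verts, List.mem_cons, List.mem_append] at h
    by_cases e : v = u
    · simp only [ins, if_pos e, verts, List.nil_append, List.cons_append]
      exact List.Perm.swap _ _ _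
    · simp only [ins, if_neg e, verts]
      rcases h with h | h | h
      · exact absurd h.symm e
      · have : u ∉ verts s := fun h' => hd u h u h' rfl
        rw [ins_of_notMem u x s this]
        refine (List.Perm.cons v ((ihc hc h).append_right _)).trans ?_
        exact List.Perm.swap _ _ _
      · have : u ∉ verts c := fun h' => hd u h' u h rfl
        rw [ins_of_notMem u x c this]
        refine (List.Perm.cons v (((ihs hs h).append_left _).trans List.perm_middle)).trans ?_
        exact List.Perm.swap _ _ _

theorem avoid_ins (D : Finset V) (u x : V) (f : LForest V) : avoid D (ins u x f) ↔ avoid D f := by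
  induction f with
  | nil => rfl
  | node v c s ihc ihs =>
    rw [ins]; split_ifs <;> simp [avoid, ihs]

theorem ind_ins (D : Finset V) (u x : V) (f : LForest V) (h : ind D (ins u x f)) : ind D f := by
  induction f with
  | nil => trivial
  | node v c s ihc ihs =>
    rw [ins] at h
    split_ifs at h
    · simp only [ind, avoid] at h ⊢; tauto
    · simp only [ind, avoid_ins] at h ⊢; tauto

theorem ind_ins_edge (D : Finset V) (u x : V) (f : LForest V) (hu : u ∈ verts f)
    (h : ind D (ins u x f)) : u ∈ D → x ∉ D := by
  induction f with
  | nil => simp [verts] at hu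
  | node v c s ihc ihs =>
    simp only [verts, List.mem_cons, List.mem_append] at hu
    rw [ins] at h
    split_ifs at h with e
    · subst e; simp only [ind, avoid] at h; tauto
    · simp only [ind] at h
      rcases hu with hu | hu | hu
      · exact absurd hu.symm e
      · exact ihc hu h.2.1
      · exact ihs hu h.2.2

end LForest

namespace SimpleGraph

variable {V : Type*} [DecidableEq V]

/-- every nonempty vertex set has a vertex with at most one neighbour in it -/
def OneDegen (G : SimpleGraph V) : Prop :=
  ∀ B : Finset V, B.Nonempty → ∃ v ∈ B, ∀ x ∈ B, ∀ y ∈ B, G.Adj v x → G.Adj v y → x = y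

theorem OneDegen.exists_forest {G : SimpleGraph V} (hG : G.OneDegen) (B : Finset V) :
    ∃ f : LForest V, f.verts.Nodup ∧ (∀ v, v ∈ f.verts ↔ v ∈ B) ∧
      ∀ D : Finset V, f.ind D → ∀ x ∈ B, ∀ y ∈ B, x ∈ D → y ∈ D → ¬ G.Adj x y := by
  induction hk : B.card generalizing B with
  | zero =>
    rw [Finset.card_eq_zero] at hk
    subst hk
    exact ⟨LForest.nil, by simp [LForest.verts], by simp [LForest.verts], by simp⟩
  | succ k ih =>
    have hB : B.Nonempty := by rw [← Finset.card_pos]; omega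
    obtain ⟨v, hv, hv'⟩ := hG B hB
    obtain ⟨f, h1, h2, h3⟩ := ih (B.erase v) (by rw [Finset.card_erase_of_mem hv]; omega)
    have hvf : v ∉ f.verts := by rw [h2]; simp
    by_cases hu : ∃ u ∈ B, G.Adj v u
    · obtain ⟨u, huB, hvu⟩ := hu
      have huf : u ∈ f.verts := by rw [h2]; simp [huB, hvu.ne']
      have hp := LForest.verts_ins u v f h1 huf
      refine ⟨f.ins u v, ?_, ?_, ?_⟩
      · rw [hp.nodup_iff]; simp [hvf, h1]
      · intro w
        rw [hp.mem_iff, List.mem_cons, h2, Finset.mem_erase]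
        by_cases e : w = v
        · simp [e, hv]
        · simp [e]
      · intro D hD x hx y hy hxD hyD hxy
        have hi := h3 D (LForest.ind_ins D u v f hD)
        have he := LForest.ind_ins_edge D u v f huf hD
        by_cases ex : x = v
        · subst ex
          have : y = u := hv' y hy u huB hxy hvu
          subst this
          exact he hyD hxD
        by_cases ey : y = v
        · subst ey
          have : x = u := hv' x hx u huB hxy.symm hvu
          subst this
          exact he hxD hyD
        exact hi x (by simp [ex, hx]) y (by simp [ey, hy]) hxD hyD hxy
    · push Not at hu
      refine ⟨LForest.node v LForest.nil f, ?_, ?_, ?_⟩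
      · simp [LForest.verts, hvf, h1]
      · intro w
        simp only [LForest.verts, List.nil_append, List.mem_cons, h2, Finset.mem_erase]
        by_cases e : w = v
        · simp [e, hv]
        · simp [e]
      · intro D hD x hx y hy hxD hyD hxy
        simp only [LForest.ind] at hD
        by_cases ex : x = v
        · subst ex; exact hu y hy hxy
        by_cases ey : y = v
        · subst ey; exact hu x hx hxy.symm
        exact h3 D hD.2.2 x (by simp [ex, hx]) y (by simp [ey, hy]) hxD hyD hxy

/-! ## The game -/

theorem exists_maxIndep (G : SimpleGraph V) (M D : Finset V) (hD : D ⊆ M)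
    (hi : ∀ u ∈ D, ∀ v ∈ D, ¬ G.Adj u v) : ∃ E, D ⊆ E ∧ G.MaxIndepSubset M E := by
  classical
  obtain ⟨E, hDE, hE⟩ := (M.powerset.filter
    fun E => ∀ u ∈ E, ∀ v ∈ E, ¬ G.Adj u v).exists_le_maximal (a := D) (by simp only [Finset.mem_filter, Finset.mem_powerset]; exact ⟨hD, hi⟩)
  have hE1 := hE.1
  simp only [Finset.mem_filter, Finset.mem_powerset] at hE1
  refine ⟨E, hDE, hE1.1, hE1.2, ?_⟩
  intro v hv hvE
  by_contra hcon
  push Not at hcon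
  have : insert v E ≤ E := by
    apply hE.2 _ (Finset.subset_insert v E)
    simp only [Finset.mem_filter, Finset.mem_powerset]
    refine ⟨Finset.insert_subset hv hE1.1, ?_⟩
    intro a ha b hb hab
    rcases Finset.mem_insert.1 ha with rfl | haE
    · rcases Finset.mem_insert.1 hb with rfl | hb
      · exact hab.ne rfl
      · exact hcon b hb hab.symm
    · rcases Finset.mem_insert.1 hb with hbv | hb
      · subst hbv; exact hcon a (by assumption) hab
      · exact hE1.2 a (by assumption) b hb hab
  exact hvE (this (Finset.mem_insert_self v E))

theorem slowAux_le_iff (G : SimpleGraph V) (k : ℕ) (A : Finset V) (N : ℕ) :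
    G.slowAux (k + 1) A ≤ N ↔ ∀ M ⊆ A, M.Nonempty →
      ∃ D, G.MaxIndepSubset M D ∧ M.card + G.slowAux k (A \ D) ≤ N := by
  rw [slowAux, Finset.sup_le_iff]
  simp only [Finset.mem_filter, Finset.mem_powerset, and_imp]
  refine forall_congr' fun M => forall_congr' fun _ => forall_congr' fun _ => ?_
  constructor
  · intro h
    have hne : {m | ∃ D : Finset V, G.MaxIndepSubset M D ∧ m = G.slowAux k (A \ D)}.Nonempty := by
      obtain ⟨E, _, hE⟩ := G.exists_maxIndep M ∅ (by simp) (by simp)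
      exact ⟨_, E, hE, rfl⟩
    obtain ⟨D, hD, e⟩ := Nat.sInf_mem hne
    exact ⟨D, hD, by rw [← e]; exact h⟩
  · rintro ⟨D, hD, h⟩
    refine le_trans ?_ h
    have hm : G.slowAux k (A \ D) ∈
        {m | ∃ D : Finset V, G.MaxIndepSubset M D ∧ m = G.slowAux k (A \ D)} := ⟨D, hD, rfl⟩
    exact Nat.add_le_add_left (Nat.sInf_le hm) _

theorem slowAux_mono (G : SimpleGraph V) (k : ℕ) {A B : Finset V} (h : A ⊆ B) :
    G.slowAux k A ≤ G.slowAux k B := by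
  induction k generalizing A B with
  | zero => simp [slowAux]
  | succ k ih =>
    rw [slowAux_le_iff]
    intro M hM hne
    obtain ⟨D, hD, h'⟩ := (G.slowAux_le_iff k B _).1 le_rfl M (hM.trans h) hne
    exact ⟨D, hD, le_trans (Nat.add_le_add_left (ih (Finset.sdiff_subset_sdiff h le_rfl)) _) h'⟩

theorem slowAux_upper [Fintype V] (G : SimpleGraph V) (f : LForest V) (hf : f.verts.Nodup)
    (hv : ∀ v, v ∈ f.verts)
    (hD : ∀ D : Finset V, f.ind D → ∀ x ∈ D, ∀ y ∈ D, ¬ G.Adj x y) (k : ℕ) (A : Finset V) :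
    2 * G.slowAux k A + f.oc A false ≤ 3 * A.card := by
  have hc : ∀ X : Finset V, f.cnt X = X.card := by
    intro X
    rw [LForest.cnt_eq_card f hf]
    congr 1
    ext w; simp [hv]
  induction k generalizing A with
  | zero =>
    have := LForest.oc_le A f false
    rw [hc] at this
    simp [slowAux]; omega
  | succ k ih =>
    have hle : f.oc A false ≤ 3 * A.card := by
      have := LForest.oc_le A f false
      rw [hc] at this
      omega
    suffices G.slowAux (k + 1) A ≤ (3 * A.card - f.oc A false) / 2 by omega
    rw [slowAux_le_iff]
    intro M hM _
    obtain ⟨_, _, _, D, ⟨d1, d2, d3⟩, hval⟩ := LForest.inv_all A M hM f hf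
    obtain ⟨E, hDE, hE⟩ := G.exists_maxIndep M D d1 (hD D d3)
    refine ⟨E, hE, ?_⟩
    have h1 := G.slowAux_mono k (Finset.sdiff_subset_sdiff (le_refl A) hDE)
    have h2 := ih (A \ D)
    have h3 := LForest.cnt_sdiff (d1.trans hM) f
    simp only [hc] at h3 hval
    omega

theorem OneDegen.sumColorCost_le [Fintype V] {G : SimpleGraph V} (hG : G.OneDegen) :
    G.sumColorCost ≤ 3 * Fintype.card V / 2 := by
  obtain ⟨f, h1, h2, h3⟩ := hG.exists_forest Finset.univ
  have := G.slowAux_upper f h1 (fun v => by simp [h2])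
    (fun D hD x hx y hy => h3 D hD x (by simp) y (by simp) hx hy) (Fintype.card V) Finset.univ
  rw [sumColorCost]
  simp only [Finset.card_univ] at this
  omega

theorem IsTree.oneDegen {G : SimpleGraph V} (hG : G.IsTree) : G.OneDegen := by
  intro B hB
  obtain ⟨r, -⟩ := id hB
  obtain ⟨v, hv, hmax⟩ := B.exists_max_image (fun w => G.dist w r) hB
  refine ⟨v, hv, ?_⟩
  have key : ∀ x ∈ B, G.Adj v x → ∃ p : G.Walk x r, ∃ h : G.Adj v x, (Walk.cons h p).IsPath := by
    intro x hx hvx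
    obtain ⟨p, hp⟩ := hG.connected.exists_walk_length_eq_dist x r
    refine ⟨p, hvx, Walk.isPath_of_length_eq_dist _ ?_⟩
    have h1 := hG.dist_eq_dist_add_one_of_adj r hvx
    have h2 := hmax x hx
    rw [G.dist_comm (u := r), G.dist_comm (u := r)] at h1
    simp only [Walk.length_cons]
    omega
  intro x hx y hy hvx hvy
  obtain ⟨p, h1, hp⟩ := key x hx hvx
  obtain ⟨q, h2, hq⟩ := key y hy hvy
  have := (hG.existsUnique_path v r).unique hp hq
  have := congrArg Walk.snd this
  simpa using this

theorem pathGraph_oneDegen (n : ℕ) : (pathGraph n).OneDegen := by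
  intro B hB
  refine ⟨B.max' hB, B.max'_mem hB, ?_⟩
  intro x hx y hy h1 h2
  have a := B.le_max' x hx
  have b := B.le_max' y hy
  rw [pathGraph_adj] at h1 h2
  rw [Fin.le_def] at a b
  ext
  omega

/-- Lister's strategy on a graph containing a matching. -/
theorem slowAux_lower {ι : Type*} [DecidableEq ι] (G : SimpleGraph V) (x y : ι → V)
    (hx : Function.Injective x) (hy : Function.Injective y) (hxy : ∀ i j, x i ≠ y j)
    (k : ℕ) (A : Finset V) (S : Finset ι) (hk : A.card ≤ k)
    (hS : ∀ i ∈ S, x i ∈ A ∧ y i ∈ A ∧ G.Adj (x i) (y i)) :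
    A.card + S.card ≤ G.slowAux k A := by
  induction k generalizing A S with
  | zero =>
    have hA : A = ∅ := by rw [← Finset.card_eq_zero]; omega
    subst hA
    have : S = ∅ := by
      rw [Finset.eq_empty_iff_forall_notMem]
      intro i hi
      simpa using (hS i hi).1
    simp [this]
  | succ k ih =>
    have hval := (G.slowAux_le_iff k A _).1 le_rfl
    rcases S.eq_empty_or_nonempty with rfl | ⟨i, hi⟩
    · rcases A.eq_empty_or_nonempty with rfl | ⟨a, ha⟩
      · simp
      · obtain ⟨D, hD, h⟩ := hval {a} (by simpa using ha) (by simp)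
        have h1 := Finset.card_le_card hD.1
        have h2 : 1 ≤ D.card := by
          rw [Nat.one_le_iff_ne_zero, Ne, Finset.card_eq_zero]
          rintro rfl
          simpa using hD.2.2 a (by simp) (by simp)
        have hDA : D ⊆ A := hD.1.trans (by simpa using ha)
        have h3 := Finset.card_sdiff_add_card_eq_card hDA
        have h4 := ih (A \ D) ∅ (by omega) (by simp)
        simp at h h1 h4 ⊢
        omega
    · obtain ⟨hxi, hyi, hadj⟩ := hS i hi
      have hsub : ({x i, y i} : Finset V) ⊆ A := by
        intro w hw
        simp only [Finset.mem_insert, Finset.mem_singleton] at hw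
        rcases hw with rfl | rfl <;> assumption
      obtain ⟨D, hD, h⟩ := hval {x i, y i} hsub (by simp)
      have hDA : D ⊆ A := hD.1.trans hsub
      have h1 : D.card ≤ 1 := by
        rw [Finset.card_le_one]
        intro a ha b hb
        have ha' := hD.1 ha
        have hb' := hD.1 hb
        simp only [Finset.mem_insert, Finset.mem_singleton] at ha' hb'
        have hab := hD.2.1 a ha b hb
        have hba := hD.2.1 b hb a ha
        rcases ha' with rfl | rfl <;> rcases hb' with rfl | rfl <;> first | rfl | contradiction
      have h2 : 1 ≤ D.card := by
        rw [Nat.one_le_iff_ne_zero, Ne, Finset.card_eq_zero]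
        rintro rfl
        simpa using hD.2.2 (x i) (by simp) (by simp)
      have h3 := Finset.card_sdiff_add_card_eq_card hDA
      have hcard : ({x i, y i} : Finset V).card = 2 := Finset.card_pair (hxy i i)
      have h5 := Finset.card_erase_add_one hi
      have h4 := ih (A \ D) (S.erase i) (by omega) (by
        intro j hj
        obtain ⟨hji, hjS⟩ := Finset.mem_erase.1 hj
        obtain ⟨p, q, r⟩ := hS j hjS
        refine ⟨Finset.mem_sdiff.2 ⟨p, fun hD' => ?_⟩, Finset.mem_sdiff.2 ⟨q, fun hD' => ?_⟩, r⟩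
        · have := hD.1 hD'
          simp only [Finset.mem_insert, Finset.mem_singleton] at this
          rcases this with e | e
          · exact hji (hx e)
          · exact hxy _ _ e
        · have := hD.1 hD'
          simp only [Finset.mem_insert, Finset.mem_singleton] at this
          rcases this with e | e
          · exact hxy _ _ e.symm
          · exact hji (hy e))
      omega

theorem le_sumColorCost_pathGraph (n : ℕ) : 3 * n / 2 ≤ (pathGraph n).sumColorCost := by
  have := slowAux_lower (pathGraph n) (ι := Fin (n / 2))
    (fun i => ⟨2 * i, by omega⟩) (fun i => ⟨2 * i + 1, by omega⟩)
    (by intro i j h; simp at h; omega) (by intro i j h; simp at h; omega)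
    (by intro i j h; simp at h; omega) (Fintype.card (Fin n)) Finset.univ Finset.univ
    (by simp) (by intro i _; simp [pathGraph_adj])
  rw [sumColorCost]
  refine le_trans ?_ this
  simp only [Finset.card_univ, Fintype.card_fin]
  omega

end SimpleGraph

/-- Every tree `T` on `n ≥ 1` vertices satisfies `𝓈(T) ≤ ⌊3n/2⌋`, and the path
`P_n` satisfies `𝓈(P_n) = ⌊3n/2⌋`. -/
theorem sumColorCost_tree_le_and_path {V : Type*} [Fintype V] [DecidableEq V]
    (T : SimpleGraph V) (hT : T.IsTree) (hn : 1 ≤ Fintype.card V) :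
    T.sumColorCost ≤ 3 * Fintype.card V / 2 ∧
      (SimpleGraph.pathGraph (Fintype.card V)).sumColorCost = 3 * Fintype.card V / 2 := by
  refine ⟨hT.oneDegen.sumColorCost_le,
    le_antisymm ?_ (SimpleGraph.le_sumColorCost_pathGraph _)⟩
  simpa using (SimpleGraph.pathGraph_oneDegen (Fintype.card V)).sumColorCost_le
end
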